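/- arXiv:math/0404459 — 2 statements merged into one kernel-verified Lean document; each statement's English description precedes it below -/
import Mathlib

section
/- The group C is isomorphic to the semidirect product K ⋊ S₁₈, where S₁₈ acts on K by the restriction of the index-permutation action φ (which preserves K). -/
/-- The vertices of the graph `T`: the 18 triangles of the triangulation of
the torus obtained from the 3×3 square grid with opposite sides identified.
A triangle is labelled by its unit cell `(a, b) : (ℤ/3)²` together with a
Boolean which is `false` for the lower triangle (below the diagonal of the
cell) and `true` for the upper one. -/
abbrev VT : Type := (ZMod 3 × ZMod 3) × Bool

/-- The 27 edges of the graph `T`, joining pairs of distinct triangles which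
share a common side: edge `(c, 0)` is dual to the diagonal of the cell `c`,
edge `(c, 1)` to the left side of `c` and edge `(c, 2)` to the bottom side
of `c`. -/
abbrev ET : Type := (ZMod 3 × ZMod 3) × Fin 3

/-- One endpoint of an edge of `T`. -/
def endA (e : ET) : VT :=
  if e.2 = 1 then (e.1, true) else (e.1, false)

/-- The other endpoint of an edge of `T`. -/
def endB (e : ET) : VT :=
  if e.2 = 0 then (e.1, true)
  else if e.2 = 1 then ((e.1.1 - 1, e.1.2), false)
  else ((e.1.1, e.1.2 - 1), true)

/-- Incidence between edges and vertices of `T`. -/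
def incidentT (e : ET) (v : VT) : Prop := v = endA e ∨ v = endB e

/-- For each of the 9 grid vertices `p` of the torus, the six edges (in cyclic
order) of the hexagonal cycle in `T` formed by the six triangles
containing `p`. -/
def hexEdge (p : ZMod 3 × ZMod 3) : Fin 6 → ET := fun k =>
  if k = 0 then (p, 2)
  else if k = 1 then (p, 0)
  else if k = 2 then (p, 1)
  else if k = 3 then ((p.1 - 1, p.2), 2)
  else if k = 4 then ((p.1 - 1, p.2 - 1), 0)
  else ((p.1, p.2 - 1), 1)

/-- The free-group generator corresponding to an edge `e` of `T`. -/
def fe (e : ET) : FreeGroup ET := FreeGroup.of e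

/-- The relations of the presentation of the group `C`: `u_e² = 1`;
`u_e u_f = u_f u_e` when `e, f` have no common vertex;
`u_e u_f u_e = u_f u_e u_f` when `e, f` share exactly one vertex; and the
cyclic relation `u_{e₁} u_{e₂} u_{e₃} u_{e₄} u_{e₅} = u_{e₂} u_{e₃} u_{e₄} u_{e₅} u_{e₆}`
for each of the nine hexagonal cycles. -/
def CRels : Set (FreeGroup ET) :=
  { r | (∃ e : ET, r = fe e * fe e)
      ∨ (∃ e f : ET, (∀ v : VT, ¬ (incidentT e v ∧ incidentT f v)) ∧
            r = fe e * fe f * (fe f * fe e)⁻¹)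
      ∨ (∃ e f : ET, (∃! v : VT, incidentT e v ∧ incidentT f v) ∧
            r = fe e * fe f * fe e * (fe f * fe e * fe f)⁻¹)
      ∨ (∃ p : ZMod 3 × ZMod 3,
            r = (fe (hexEdge p 0) * fe (hexEdge p 1) * fe (hexEdge p 2) *
                 fe (hexEdge p 3) * fe (hexEdge p 4)) *
                (fe (hexEdge p 1) * fe (hexEdge p 2) * fe (hexEdge p 3) *
                 fe (hexEdge p 4) * fe (hexEdge p 5))⁻¹) }

/-- The group `C`, given by the above presentation. -/
abbrev Cgrp : Type := PresentedGroup CRels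

/-- The generator `u_e` of `C` corresponding to the edge `e` of `T`. -/
def uC (e : ET) : Cgrp := PresentedGroup.of e

/-- The transposition in `S₁₈` exchanging the two triangles joined by the
edge `e` of `T`. -/
def tE (e : ET) : Equiv.Perm VT := Equiv.swap (endA e) (endB e)

/-- Generators of the group `H`: `x i`, `y i` for `i : Fin 18`, and `z`. -/
inductive HGen : Type
  | x : Fin 18 → HGen
  | y : Fin 18 → HGen
  | z : HGen

/-- The free-group generator corresponding to `x i`. -/
def fx (i : Fin 18) : FreeGroup HGen := FreeGroup.of (HGen.x i)
/-- The free-group generator corresponding to `y i`. -/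
def fy (i : Fin 18) : FreeGroup HGen := FreeGroup.of (HGen.y i)
/-- The free-group generator corresponding to `z`. -/
def fz : FreeGroup HGen := FreeGroup.of HGen.z

/-- The relations of the presentation of `H`:
`[xᵢ, xⱼ] = [yᵢ, yⱼ] = [xᵢ, yⱼ] = 1` for `i ≠ j`, `[xᵢ, yᵢ] = z`,
and `z` commutes with all the generators. -/
def HRels : Set (FreeGroup HGen) :=
  { r | (∃ i j : Fin 18, i ≠ j ∧ r = fx i * fx j * (fx i)⁻¹ * (fx j)⁻¹)
      ∨ (∃ i j : Fin 18, i ≠ j ∧ r = fy i * fy j * (fy i)⁻¹ * (fy j)⁻¹)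
      ∨ (∃ i j : Fin 18, i ≠ j ∧ r = fx i * fy j * (fx i)⁻¹ * (fy j)⁻¹)
      ∨ (∃ i : Fin 18, r = fx i * fy i * (fx i)⁻¹ * (fy i)⁻¹ * fz⁻¹)
      ∨ (∃ i : Fin 18, r = fx i * fz * (fx i)⁻¹ * fz⁻¹)
      ∨ (∃ i : Fin 18, r = fy i * fz * (fy i)⁻¹ * fz⁻¹) }

/-- The group `H`, given by the above presentation. -/
abbrev Hgrp : Type := PresentedGroup HRels

/-- The generator `xᵢ` of `H`. -/
def xH (i : Fin 18) : Hgrp := PresentedGroup.of (HGen.x i)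
/-- The generator `yᵢ` of `H`. -/
def yH (i : Fin 18) : Hgrp := PresentedGroup.of (HGen.y i)
/-- The generator `z` of `H`. -/
def zH : Hgrp := PresentedGroup.of HGen.z

section Relations

theorem uC_mul_self (e : ET) : uC e * uC e = 1 := by
  have := PresentedGroup.one_of_mem (rels := CRels) (x := fe e * fe e) (Or.inl ⟨e, rfl⟩)
  rwa [map_mul] at this

theorem uC_commute_of_disjoint {e f : ET} (h : endA e ≠ endA f ∧ endA e ≠ endB f ∧
    endB e ≠ endA f ∧ endB e ≠ endB f) : uC e * uC f = uC f * uC e := by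
  have := PresentedGroup.one_of_mem (rels := CRels) (x := fe e * fe f * (fe f * fe e)⁻¹)
    (Or.inr (Or.inl ⟨e, f, by
      rintro v ⟨rfl | rfl, hv | hv⟩
      exacts [h.1 hv, h.2.1 hv, h.2.2.1 hv, h.2.2.2 hv], rfl⟩))
  rw [map_mul, map_inv, mul_inv_eq_one] at this
  simp only [map_mul] at this
  exact this

theorem endA_ne_endB (e : ET) : endA e ≠ endB e := by
  revert e
  decide

theorem eq_of_same_ends : ∀ e f : ET, endA e = endA f ∧ endB e = endB f ∨
    endA e = endB f ∧ endB e = endA f → e = f := by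
  decide

theorem uC_braid_of_meet {e f : ET} (hne : e ≠ f) (h : endA e = endA f ∨ endA e = endB f ∨
    endB e = endA f ∨ endB e = endB f) : uC e * uC f * uC e = uC f * uC e * uC f := by
  have hex : ∃ v, incidentT e v ∧ incidentT f v := by
    rcases h with h | h | h | h
    exacts [⟨_, Or.inl rfl, Or.inl h⟩, ⟨_, Or.inl rfl, Or.inr h⟩, ⟨_, Or.inr rfl, Or.inl h⟩,
      ⟨_, Or.inr rfl, Or.inr h⟩]
  obtain ⟨v, hv, hv'⟩ := hex
  have := PresentedGroup.one_of_mem (rels := CRels)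
    (x := fe e * fe f * fe e * (fe f * fe e * fe f)⁻¹)
    (Or.inr (Or.inr (Or.inl ⟨e, f, ⟨v, ⟨hv, hv'⟩, by
      rintro w ⟨hw, hw'⟩
      by_contra hwv
      refine hne (eq_of_same_ends e f ?_)
      rcases hv with rfl | rfl <;> rcases hw with rfl | rfl <;> rcases hv' with h1 | h1 <;>
        rcases hw' with h2 | h2 <;> simp_all [endA_ne_endB, (endA_ne_endB _).symm]⟩, rfl⟩)))
  rw [map_mul, map_inv, mul_inv_eq_one] at this
  simp only [map_mul] at this
  exact this

theorem hexagon_rotate {G : Type*} [Group G] {a b c d e f : G} (ha : a * a = 1) (hb : b * b = 1)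
    (hc : c * c = 1) (hd : d * d = 1) (he : e * e = 1)
    (hf : f * f = 1) (hac : a * c = c * a) (had : a * d = d * a)
    (hae : a * e = e * a) (hab : a * b * a = b * a * b) (haf : f * a * f = a * f * a)
    (h : a * b * c * d * e = b * c * d * e * f) : b * c * d * e * f = c * d * e * f * a := by
  have cancel : ∀ {x : G}, x * x = 1 → ∀ y, x * (x * y) = y := fun h y => by
    rw [← mul_assoc, h, one_mul]
  have hX : c * d * e * f * e * d * c = b * a * b := by
    have : b * (b * c * d * e * f) * e * d * c = b * (a * b * c * d * e) * e * d * c := by rw [h]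
    simpa only [mul_assoc, cancel hb, cancel he, cancel hd, hc, mul_one] using this
  have h1 : c * d * e * a = a * (c * d * e) := by
    rw [mul_assoc, ← hae, ← mul_assoc, mul_assoc c, ← had, ← mul_assoc, ← hac]
    simp only [mul_assoc]
  have h2 : a * e * d * c = e * d * c * a := by
    rw [hae, mul_assoc e, had, mul_assoc, mul_assoc d, hac]
    simp only [mul_assoc]
  have hY : c * d * e * f * a * f * e * d * c = b := calc
    c * d * e * f * a * f * e * d * c = c * d * e * (f * a * f) * e * d * c := by
        simp only [mul_assoc]
    _ = (c * d * e * a) * f * (a * e * d * c) := by rw [haf]; simp only [mul_assoc]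
    _ = a * (c * d * e * f * e * d * c) * a := by rw [h1, h2]; simp only [mul_assoc]
    _ = a * (a * b * a) * a := by rw [hX, hab]
    _ = b := by simp only [mul_assoc, cancel ha, ha, mul_one]
  calc b * c * d * e * f = (c * d * e * f * a * f * e * d * c) * c * d * e * f := by rw [hY]
    _ = c * d * e * f * a := by
      simp only [mul_assoc, cancel hc, cancel hd, cancel he, hf, mul_one]

theorem uC_hexagon (p : ZMod 3 × ZMod 3) (k : Fin 6) :
    uC (hexEdge p k) * uC (hexEdge p (k + 1)) * uC (hexEdge p (k + 2)) * uC (hexEdge p (k + 3)) *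
        uC (hexEdge p (k + 4)) =
      uC (hexEdge p (k + 1)) * uC (hexEdge p (k + 2)) * uC (hexEdge p (k + 3)) *
        uC (hexEdge p (k + 4)) * uC (hexEdge p (k + 5)) := by
  have key : ∀ n : ℕ, ∀ k : Fin 6, k.val = n →
      uC (hexEdge p k) * uC (hexEdge p (k + 1)) * uC (hexEdge p (k + 2)) *
        uC (hexEdge p (k + 3)) * uC (hexEdge p (k + 4)) =
      uC (hexEdge p (k + 1)) * uC (hexEdge p (k + 2)) * uC (hexEdge p (k + 3)) *
        uC (hexEdge p (k + 4)) * uC (hexEdge p (k + 5)) := by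
    intro n
    induction n with
    | zero =>
      intro k hk
      obtain rfl : k = 0 := Fin.ext hk
      have := PresentedGroup.one_of_mem (rels := CRels) (Or.inr (Or.inr (Or.inr ⟨p, rfl⟩)))
      rw [map_mul, map_inv, mul_inv_eq_one] at this
      simp only [map_mul] at this
      exact this
    | succ n ih =>
      intro k hk
      obtain ⟨l, rfl⟩ : ∃ l : Fin 6, k = l + 1 := ⟨k - 1, by simp⟩
      have hdisj : ∀ (p : ZMod 3 × ZMod 3) (l m : Fin 6), m = 2 ∨ m = 3 ∨ m = 4 →
          endA (hexEdge p l) ≠ endA (hexEdge p (l + m)) ∧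
          endA (hexEdge p l) ≠ endB (hexEdge p (l + m)) ∧
          endB (hexEdge p l) ≠ endA (hexEdge p (l + m)) ∧
          endB (hexEdge p l) ≠ endB (hexEdge p (l + m)) := by
        decide
      have hmeet : ∀ (p : ZMod 3 × ZMod 3) (l : Fin 6), hexEdge p l ≠ hexEdge p (l + 1) ∧
          (endA (hexEdge p l) = endA (hexEdge p (l + 1)) ∨
          endA (hexEdge p l) = endB (hexEdge p (l + 1)) ∨
          endB (hexEdge p l) = endA (hexEdge p (l + 1)) ∨
          endB (hexEdge p l) = endB (hexEdge p (l + 1))) := by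
        decide
      have hl : l.val = n := by
        revert hk
        fin_cases l <;> simp +contextual
      have h5 : l + 5 + 1 = l := by rw [add_assoc]; exact add_zero l
      have hbr := hmeet p (l + 5)
      rw [h5] at hbr
      have := hexagon_rotate (uC_mul_self _) (uC_mul_self _) (uC_mul_self _) (uC_mul_self _)
        (uC_mul_self _) (uC_mul_self _)
        (uC_commute_of_disjoint (hdisj p l 2 (by decide)))
        (uC_commute_of_disjoint (hdisj p l 3 (by decide)))
        (uC_commute_of_disjoint (hdisj p l 4 (by decide)))
        (uC_braid_of_meet (hmeet p l).1 (hmeet p l).2)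
        (uC_braid_of_meet hbr.1 hbr.2) (ih l hl)
      have h6 : ∀ m : Fin 6, l + 1 + m = l + (1 + m) := fun m => add_assoc l 1 m
      rw [h6, h6, h6, h6, h6, show (1 : Fin 6) + 5 = 0 from rfl, add_zero]
      exact this
  exact key k k rfl

theorem uC_hexagon_eq (p : ZMod 3 × ZMod 3) (k : Fin 6) :
    uC (hexEdge p k) = uC (hexEdge p (k + 1)) * (uC (hexEdge p (k + 2)) * (uC (hexEdge p (k + 3)) *
      (uC (hexEdge p (k + 4)) * uC (hexEdge p (k + 5)) * uC (hexEdge p (k + 4))) *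
      uC (hexEdge p (k + 3))) * uC (hexEdge p (k + 2))) * uC (hexEdge p (k + 1)) := by
  calc uC (hexEdge p k) = (uC (hexEdge p k) * uC (hexEdge p (k + 1)) * uC (hexEdge p (k + 2)) *
        uC (hexEdge p (k + 3)) * uC (hexEdge p (k + 4))) * uC (hexEdge p (k + 4)) *
        uC (hexEdge p (k + 3)) * uC (hexEdge p (k + 2)) * uC (hexEdge p (k + 1)) := by
        simp only [mul_assoc, uC_mul_self, mul_one]
    _ = _ := by
      rw [uC_hexagon]
      simp only [mul_assoc]

end Relations

/-- The integral Heisenberg group of rank `2·18+1`, in coordinates. -/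
@[ext] structure Heis where
  a : Fin 18 → ℤ
  b : Fin 18 → ℤ
  c : ℤ

namespace Heis

instance : Mul Heis := ⟨fun g h => ⟨g.a + h.a, g.b + h.b, g.c + h.c + g.a ⬝ᵥ h.b⟩⟩
instance : One Heis := ⟨⟨0, 0, 0⟩⟩
instance : Inv Heis := ⟨fun g => ⟨-g.a, -g.b, -g.c + g.a ⬝ᵥ g.b⟩⟩

@[simp] theorem mul_a (g h : Heis) : (g * h).a = g.a + h.a := rfl
@[simp] theorem mul_b (g h : Heis) : (g * h).b = g.b + h.b := rfl
@[simp] theorem mul_c (g h : Heis) : (g * h).c = g.c + h.c + g.a ⬝ᵥ h.b := rfl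
@[simp] theorem one_a : (1 : Heis).a = 0 := rfl
@[simp] theorem one_b : (1 : Heis).b = 0 := rfl
@[simp] theorem one_c : (1 : Heis).c = 0 := rfl
@[simp] theorem inv_a (g : Heis) : (g⁻¹).a = -g.a := rfl
@[simp] theorem inv_b (g : Heis) : (g⁻¹).b = -g.b := rfl
@[simp] theorem inv_c (g : Heis) : (g⁻¹).c = -g.c + g.a ⬝ᵥ g.b := rfl

instance : Group Heis := Group.ofLeftAxioms
  (fun g h k => by
    ext <;> simp [add_assoc, add_dotProduct, dotProduct_add]
    ring)
  (fun g => by ext <;> simp)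
  (fun g => by ext <;> simp)

/-- Permutation of the coordinates. -/
def perm : Equiv.Perm (Fin 18) →* MulAut Heis where
  toFun σ :=
    { toFun := fun g => ⟨g.a ∘ σ.symm, g.b ∘ σ.symm, g.c⟩
      invFun := fun g => ⟨g.a ∘ σ, g.b ∘ σ, g.c⟩
      left_inv := fun g => by ext <;> simp
      right_inv := fun g => by ext <;> simp
      map_mul' := fun g h => by
        ext
        · rfl
        · rfl
        · simp [← comp_equiv_symm_dotProduct, Function.comp_assoc] }
  map_one' := by ext <;> rfl
  map_mul' := fun σ τ => by ext <;> rfl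

@[simp] theorem perm_a (σ : Equiv.Perm (Fin 18)) (g : Heis) : (perm σ g).a = g.a ∘ σ.symm := rfl
@[simp] theorem perm_b (σ : Equiv.Perm (Fin 18)) (g : Heis) : (perm σ g).b = g.b ∘ σ.symm := rfl
@[simp] theorem perm_c (σ : Equiv.Perm (Fin 18)) (g : Heis) : (perm σ g).c = g.c := rfl

/-- The root `δᵢ - δⱼ`. -/
def root (i j : Fin 18) : Fin 18 → ℤ := Pi.single i 1 - Pi.single j 1

theorem root_comp (i j : Fin 18) (σ : Equiv.Perm (Fin 18)) :
    root i j ∘ σ.symm = root (σ i) (σ j) := by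
  ext k
  simp [root, Pi.single_apply, Equiv.symm_apply_eq]

theorem root_dotProduct_root (i j k l : Fin 18) :
    root i j ⬝ᵥ root k l =
      ((if i = k then 1 else 0) - (if j = k then 1 else 0)) -
        ((if i = l then 1 else 0) - (if j = l then 1 else 0)) := by
  simp [root, dotProduct_sub, Pi.single_apply, eq_comm]

theorem root_add_root (i j k : Fin 18) : root i j + root j k = root i k := by
  simp [root]

theorem root_swap (i j : Fin 18) : root j i = - root i j := by
  simp [root]

@[simp] theorem root_self (i : Fin 18) : root i i = 0 := by
  simp [root]

/-- The element `xᵢᵐ yᵢⁿ (xⱼᵐ yⱼⁿ)⁻¹` where `g = (m, n)`. -/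
def diff (g : ℤ × ℤ) (i j : Fin 18) : Heis := ⟨g.1 • root i j, g.2 • root i j, g.1 * g.2⟩

/-- The ambient group `Heis ⋊ S₁₈`. -/
abbrev Amb : Type := Heis ⋊[perm] Equiv.Perm (Fin 18)

/-- The reflection exchanging `i` and `j` with displacement `g`. -/
def refl (g : ℤ × ℤ) (i j : Fin 18) : Amb := ⟨diff g i j, Equiv.swap i j⟩

@[simp] theorem refl_left (g : ℤ × ℤ) (i j : Fin 18) : (refl g i j).left = diff g i j := rfl
@[simp] theorem refl_right (g : ℤ × ℤ) (i j : Fin 18) :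
    (refl g i j).right = Equiv.swap i j := rfl

theorem perm_diff (σ : Equiv.Perm (Fin 18)) (g : ℤ × ℤ) (i j : Fin 18) :
    perm σ (diff g i j) = diff g (σ i) (σ j) := by
  ext1
  · simp [diff, ← root_comp, Function.comp_def, Pi.smul_def]
  · simp [diff, ← root_comp, Function.comp_def, Pi.smul_def]
  · simp [diff]

theorem refl_symm (g : ℤ × ℤ) (i j : Fin 18) : refl g j i = refl (-g) i j := by
  ext1
  · simp [diff, root_swap i j]
  · simp [Equiv.swap_comm]

theorem inr_conj_refl (σ : Equiv.Perm (Fin 18)) (g : ℤ × ℤ) (i j : Fin 18) :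
    SemidirectProduct.inr σ * refl g i j * (SemidirectProduct.inr σ)⁻¹ =
      refl g (σ i) (σ j) := by
  ext1
  · simp [perm_diff]
  · simp [← Equiv.swap_apply_apply]

theorem refl_zero (i j : Fin 18) : refl 0 i j = SemidirectProduct.inr (Equiv.swap i j) := by
  ext1
  · ext1 <;> simp [diff]
  · simp

theorem refl_mul_self (g : ℤ × ℤ) {i j : Fin 18} (h : i ≠ j) : refl g i j * refl g i j = 1 := by
  ext1
  · rw [SemidirectProduct.mul_left, refl_left, refl_right, perm_diff, Equiv.swap_apply_left,
      Equiv.swap_apply_right]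
    ext1
    · simp [diff, root_swap i j]
    · simp [diff, root_swap i j]
    · simp [diff, -zsmul_eq_mul, root_dotProduct_root, h, h.symm]
      ring
  · simp

theorem refl_conj (g h : ℤ × ℤ) {i j k : Fin 18} (hij : i ≠ j) (hjk : j ≠ k) (hik : i ≠ k) :
    refl g i j * refl h j k * refl g i j = refl (g + h) i k := by
  ext1
  · simp only [SemidirectProduct.mul_left, SemidirectProduct.mul_right, refl_left, refl_right,
      perm_diff, Equiv.Perm.mul_apply, Equiv.swap_apply_left, Equiv.swap_apply_right,
      Equiv.swap_apply_of_ne_of_ne hik.symm hjk.symm, Equiv.swap_apply_of_ne_of_ne hij hik]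
    ext1
    · simp only [diff, mul_a, ← root_add_root i j k, Prod.fst_add]
      module
    · simp only [diff, mul_b, ← root_add_root i j k, Prod.snd_add]
      module
    · simp [diff, -zsmul_eq_mul, root_dotProduct_root, add_dotProduct, hij, hjk, hik,
        hij.symm, hjk.symm]
      ring
  · simp only [SemidirectProduct.mul_right, refl_right]
    rw [Equiv.swap_comm j k, Equiv.swap_comm i j, Equiv.swap_comm i k]
    rw [Equiv.swap_mul_swap_mul_swap hjk.symm hik.symm, Equiv.swap_comm]

theorem refl_conj' (g h : ℤ × ℤ) {i j k : Fin 18} (hij : i ≠ j) (hjk : j ≠ k) (hik : i ≠ k) :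
    refl h j k * refl g i j * refl h j k = refl (g + h) i k := by
  rw [refl_symm h k j, refl_symm g j i, refl_conj _ _ hjk.symm hij.symm hik.symm,
    refl_symm _ i k]
  congr 1
  abel

theorem refl_commute (g h : ℤ × ℤ) {i j k l : Fin 18} (hik : i ≠ k) (hil : i ≠ l)
    (hjk : j ≠ k) (hjl : j ≠ l) : refl g i j * refl h k l = refl h k l * refl g i j := by
  ext1
  · simp only [SemidirectProduct.mul_left, refl_left, refl_right,
      perm_diff, Equiv.swap_apply_of_ne_of_ne hik.symm hjk.symm,
      Equiv.swap_apply_of_ne_of_ne hil.symm hjl.symm,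
      Equiv.swap_apply_of_ne_of_ne hik hil, Equiv.swap_apply_of_ne_of_ne hjk hjl]
    ext1
    · simp [diff, add_comm]
    · simp [diff, add_comm]
    · simp [diff, -zsmul_eq_mul, root_dotProduct_root, hik, hil, hjk, hjl, hik.symm, hil.symm,
        hjk.symm, hjl.symm, add_comm]
  · simp only [SemidirectProduct.mul_right, refl_right]
    refine Equiv.Perm.Disjoint.commute fun x => ?_
    by_cases hx : x = i ∨ x = j
    · right
      rcases hx with rfl | rfl
      · exact Equiv.swap_apply_of_ne_of_ne hik hil
      · exact Equiv.swap_apply_of_ne_of_ne hjk hjl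
    · left
      push Not at hx
      exact Equiv.swap_apply_of_ne_of_ne hx.1 hx.2

/-- A Hamiltonian labelling of the triangles: consecutive labels are adjacent in `T`. -/
def pos (v : VT) : Fin 18 :=
  Fin.ofNat 18 (6 * v.1.2.val + 2 * (v.1.2 - v.1.1 + 2).val + v.2.toNat)

/-- The displacement along an edge, from `endA` to `endB`, in the universal cover of the torus. -/
def disp (e : ET) : ℤ × ℤ :=
  if e.2 = 0 then 0
  else if e.2 = 1 then (if e.1.1 = e.1.2 then 1 else 0, 0)
  else (if e.1.1 = e.1.2 + 2 then 0 else 1, if e.1.2 = 0 then 1 else 0)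

theorem pos_injective : Function.Injective pos := by
  have h : ∀ v w : VT, pos v = pos w → v = w := by decide
  exact fun v w => h v w

/-- The image of the generator `u_e` in the ambient group. -/
def edgeRefl (e : ET) : Amb := refl (disp e) (pos (endA e)) (pos (endB e))

theorem edgeRefl_mul_self (e : ET) : edgeRefl e * edgeRefl e = 1 :=
  refl_mul_self _ (pos_injective.ne (endA_ne_endB e))

theorem edgeRefl_commute (e f : ET) (h : ∀ v : VT, ¬ (incidentT e v ∧ incidentT f v)) :
    edgeRefl e * edgeRefl f = edgeRefl f * edgeRefl e := by
  simp only [incidentT, not_and_or, not_or] at h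
  have hA := h (endA e)
  have hB := h (endB e)
  simp only [not_true_eq_false, false_and, and_false, false_or] at hA hB
  exact refl_commute _ _ (pos_injective.ne hA.1) (pos_injective.ne hA.2) (pos_injective.ne hB.1)
    (pos_injective.ne hB.2)

theorem refl_braid (g h : ℤ × ℤ) {i j k : Fin 18} (hij : i ≠ j) (hjk : j ≠ k) (hik : i ≠ k) :
    refl g i j * refl h j k * refl g i j = refl h j k * refl g i j * refl h j k := by
  rw [refl_conj g h hij hjk hik, refl_conj' g h hij hjk hik]

theorem edgeRefl_eq_of_incident {e : ET} {v : VT} (h : incidentT e v) :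
    ∃ (w : VT) (g : ℤ × ℤ), incidentT e w ∧ w ≠ v ∧ edgeRefl e = refl g (pos w) (pos v) := by
  rcases h with rfl | rfl
  · exact ⟨endB e, -disp e, Or.inr rfl, (endA_ne_endB e).symm, by
      rw [← refl_symm]; rfl⟩
  · exact ⟨endA e, disp e, Or.inl rfl, endA_ne_endB e, rfl⟩

theorem edgeRefl_braid (e f : ET) (h : ∃! v : VT, incidentT e v ∧ incidentT f v) :
    edgeRefl e * edgeRefl f * edgeRefl e = edgeRefl f * edgeRefl e * edgeRefl f := by
  obtain ⟨v, ⟨he, hf⟩, huniq⟩ := h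
  obtain ⟨w, g, hw, hwv, hg⟩ := edgeRefl_eq_of_incident he
  obtain ⟨x, k, hx, hxv, hk⟩ := edgeRefl_eq_of_incident hf
  have hwx : w ≠ x := by
    rintro rfl
    exact hwv (huniq w ⟨hw, hx⟩)
  rw [hg, hk, ← neg_neg k, ← refl_symm]
  exact refl_braid _ _ (pos_injective.ne hwv) (pos_injective.ne hxv.symm) (pos_injective.ne hwx)

theorem refl_hexagon {w : Fin 6 → Fin 18} (hw : Function.Injective w) (g : Fin 6 → ℤ × ℤ)
    (hg : g 0 + g 1 + g 2 + g 3 + g 4 + g 5 = 0) :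
    refl (g 0) (w 0) (w 1) * refl (g 1) (w 1) (w 2) * refl (g 2) (w 2) (w 3) *
        refl (g 3) (w 3) (w 4) * refl (g 4) (w 4) (w 5) =
      refl (g 1) (w 1) (w 2) * refl (g 2) (w 2) (w 3) * refl (g 3) (w 3) (w 4) *
        refl (g 4) (w 4) (w 5) * refl (g 5) (w 5) (w 0) := by
  have hne : ∀ {i j : Fin 6}, i ≠ j → w i ≠ w j := fun h => hw.ne h
  have h4 := refl_conj (g 4) (g 5) (hne (show (4 : Fin 6) ≠ 5 by decide))
    (hne (show (5 : Fin 6) ≠ 0 by decide)) (hne (show (4 : Fin 6) ≠ 0 by decide))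
  have h3 := refl_conj (g 3) (g 4 + g 5) (hne (show (3 : Fin 6) ≠ 4 by decide))
    (hne (show (4 : Fin 6) ≠ 0 by decide)) (hne (show (3 : Fin 6) ≠ 0 by decide))
  have h2 := refl_conj (g 2) (g 3 + (g 4 + g 5)) (hne (show (2 : Fin 6) ≠ 3 by decide))
    (hne (show (3 : Fin 6) ≠ 0 by decide)) (hne (show (2 : Fin 6) ≠ 0 by decide))
  have h1 := refl_conj (g 1) (g 2 + (g 3 + (g 4 + g 5))) (hne (show (1 : Fin 6) ≠ 2 by decide))
    (hne (show (2 : Fin 6) ≠ 0 by decide)) (hne (show (1 : Fin 6) ≠ 0 by decide))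
  have h0 : refl (g 0) (w 0) (w 1) =
      refl (g 1 + (g 2 + (g 3 + (g 4 + g 5)))) (w 1) (w 0) := by
    rw [refl_symm _ (w 0) (w 1)]
    congr 1
    rw [eq_neg_iff_add_eq_zero, ← hg]
    abel
  have e1 := refl_mul_self (g 1) (hne (show (1 : Fin 6) ≠ 2 by decide))
  have e2 := refl_mul_self (g 2) (hne (show (2 : Fin 6) ≠ 3 by decide))
  have e3 := refl_mul_self (g 3) (hne (show (3 : Fin 6) ≠ 4 by decide))
  have e4 := refl_mul_self (g 4) (hne (show (4 : Fin 6) ≠ 5 by decide))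
  rw [h0, ← h1, ← h2, ← h3, ← h4]
  have cancel : ∀ {a : Amb}, a * a = 1 → ∀ b, a * (a * b) = b := fun h b => by
    rw [← mul_assoc, h, one_mul]
  simp only [mul_assoc, cancel e1, cancel e2, cancel e3, e4, mul_one]

theorem edgeRefl_hexagon (p : ZMod 3 × ZMod 3) :
    edgeRefl (hexEdge p 0) * edgeRefl (hexEdge p 1) * edgeRefl (hexEdge p 2) *
        edgeRefl (hexEdge p 3) * edgeRefl (hexEdge p 4) =
      edgeRefl (hexEdge p 1) * edgeRefl (hexEdge p 2) * edgeRefl (hexEdge p 3) *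
        edgeRefl (hexEdge p 4) * edgeRefl (hexEdge p 5) := by
  have hw : ∀ p, Function.Injective ![pos (endB (hexEdge p 0)), pos (endA (hexEdge p 1)),
      pos (endA (hexEdge p 2)), pos (endA (hexEdge p 3)), pos (endB (hexEdge p 4)),
      pos (endB (hexEdge p 5))] := by
    decide
  have hg : ∀ p, -disp (hexEdge p 0) + disp (hexEdge p 1) + disp (hexEdge p 2) +
      disp (hexEdge p 3) + -disp (hexEdge p 4) + -disp (hexEdge p 5) = 0 := by
    decide
  have hv : ∀ p, endA (hexEdge p 0) = endA (hexEdge p 1) ∧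
      endB (hexEdge p 1) = endA (hexEdge p 2) ∧ endB (hexEdge p 2) = endA (hexEdge p 3) ∧
      endB (hexEdge p 3) = endB (hexEdge p 4) ∧ endA (hexEdge p 4) = endB (hexEdge p 5) ∧
      endA (hexEdge p 5) = endB (hexEdge p 0) := by
    decide
  have key := refl_hexagon (hw p) ![-disp (hexEdge p 0), disp (hexEdge p 1), disp (hexEdge p 2),
      disp (hexEdge p 3), -disp (hexEdge p 4), -disp (hexEdge p 5)] (hg p)
  obtain ⟨h0, h1, h2, h3, h4, h5⟩ := hv p
  have flip : ∀ e, edgeRefl e = refl (-disp e) (pos (endB e)) (pos (endA e)) := fun e => by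
    rw [← refl_symm]; rfl
  rw [flip (hexEdge p 0), flip (hexEdge p 4), flip (hexEdge p 5), edgeRefl, edgeRefl, edgeRefl,
    h0, h1, h2, h3, h4, h5]
  exact key

/-- The comparison homomorphism from `C` to the ambient group. -/
def ofC : Cgrp →* Amb :=
  PresentedGroup.toGroup (f := edgeRefl) (by
    rintro r (⟨e, rfl⟩ | ⟨e, f, h, rfl⟩ | ⟨e, f, h, rfl⟩ | ⟨p, rfl⟩)
    · simpa [fe] using edgeRefl_mul_self e
    · simpa only [fe, map_mul, map_inv, FreeGroup.lift_apply_of, mul_inv_eq_one] using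
        edgeRefl_commute e f h
    · simpa only [fe, map_mul, map_inv, FreeGroup.lift_apply_of, mul_inv_eq_one] using
        edgeRefl_braid e f h
    · simpa only [fe, map_mul, map_inv, FreeGroup.lift_apply_of, mul_inv_eq_one] using
        edgeRefl_hexagon p)

@[simp] theorem ofC_uC (e : ET) : ofC (uC e) = edgeRefl e := PresentedGroup.toGroup.of _

end Heis

/-- The Coxeter relations of type `A_N` for the first `N` terms of a sequence. -/
structure IsCoxeterA {G : Type*} [Group G] (s : ℕ → G) (N : ℕ) : Prop where
  sq : ∀ i < N, s i * s i = 1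
  comm : ∀ i j, i + 1 < j → j < N → s i * s j = s j * s i
  braid : ∀ i, i + 1 < N → s i * s (i + 1) * s i = s (i + 1) * s i * s (i + 1)

namespace IsCoxeterA

variable {G : Type*} [Group G] {s : ℕ → G} {N : ℕ}

/-- The product `s i * s (i + 1) * ⋯ * s (i + k - 1)`. -/
def run (s : ℕ → G) : ℕ → ℕ → G
  | _, 0 => 1
  | i, k + 1 => s i * run s (i + 1) k

theorem comm_run (h : IsCoxeterA s N) {j : ℕ} : ∀ (k i : ℕ), j + 1 < i → i + k ≤ N →
    s j * run s i k = run s i k * s j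
  | 0, i, _, _ => by simp [run]
  | k + 1, i, hj, hi => by
    rw [run, ← mul_assoc, h.comm j i hj (by omega), mul_assoc,
      comm_run h k (i + 1) (by omega) (by omega), mul_assoc]

theorem shift_run (h : IsCoxeterA s N) {j : ℕ} : ∀ (k i : ℕ), i ≤ j → j + 1 < i + k → i + k ≤ N →
    s (j + 1) * run s i k = run s i k * s j
  | 0, i, _, hj, _ => by omega
  | k + 1, i, hij, hj, hi => by
    rcases hij.eq_or_lt with rfl | hlt
    · obtain ⟨k, rfl⟩ : ∃ l, k = l + 1 := ⟨k - 1, by omega⟩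
      simp only [run]
      rw [← mul_assoc, ← mul_assoc, ← h.braid i (by omega), mul_assoc,
        comm_run h k (i + 1 + 1) (by omega) (by omega)]
      simp only [mul_assoc]
    · rw [run, ← mul_assoc, ← h.comm i (j + 1) (by omega) (by omega), mul_assoc,
        shift_run h k (i + 1) (by omega) (by omega) (by omega), mul_assoc]

theorem exists_run (h : IsCoxeterA s N) {n : ℕ} (hn : n + 1 ≤ N) {w : G}
    (hw : w ∈ Subgroup.closure (s '' Set.Iio (n + 1))) :
    ∃ i k, i + k = n + 1 ∧ ∃ v ∈ Subgroup.closure (s '' Set.Iio n), w = run s i k * v := by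
  have step : ∀ j < n + 1, ∀ x : G,
      (∃ i k, i + k = n + 1 ∧ ∃ v ∈ Subgroup.closure (s '' Set.Iio n), x = run s i k * v) →
      ∃ i k, i + k = n + 1 ∧ ∃ v ∈ Subgroup.closure (s '' Set.Iio n), s j * x = run s i k * v := by
    rintro j hj x ⟨i, k, hik, v, hv, rfl⟩
    have mem : ∀ l < n, s l * v ∈ Subgroup.closure (s '' Set.Iio n) := fun l hl =>
      mul_mem (Subgroup.subset_closure ⟨l, hl, rfl⟩) hv
    rcases lt_trichotomy (j + 1) i with hji | rfl | hji
    · exact ⟨i, k, hik, s j * v, mem j (by omega), by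
        rw [← mul_assoc, comm_run h k i hji (by omega), mul_assoc]⟩
    · exact ⟨j, k + 1, by omega, v, hv, by rw [run, mul_assoc]⟩
    · rcases (Nat.lt_succ_iff.1 hji).eq_or_lt with rfl | hlt
      · obtain ⟨k, rfl⟩ : ∃ l, k = l + 1 := ⟨k - 1, by omega⟩
        exact ⟨i + 1, k, by omega, v, hv, by
          rw [run, ← mul_assoc, ← mul_assoc, h.sq i (by omega), one_mul]⟩
      · obtain ⟨j, rfl⟩ : ∃ l, j = l + 1 := ⟨j - 1, by omega⟩
        exact ⟨i, k, hik, s j * v, mem j (by omega), by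
          rw [← mul_assoc, shift_run h k i (by omega) (by omega) (by omega), mul_assoc]⟩
  induction hw using Subgroup.closure_induction_left with
  | one => exact ⟨n + 1, 0, rfl, 1, one_mem _, by simp [run]⟩
  | mul_left x hx y hy ih =>
    obtain ⟨j, hj, rfl⟩ := hx
    exact step j hj y ih
  | inv_mul_cancel x hx y hy ih =>
    obtain ⟨j, hj, rfl⟩ := hx
    have hj' : j < n + 1 := hj
    rw [inv_eq_of_mul_eq_one_left (h.sq j (by omega))]
    exact step j hj y ih

theorem eq_one_of_map_eq_one (h : IsCoxeterA s N) (π : G →* Equiv.Perm ℕ)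
    (hπ : ∀ i < N, π (s i) = Equiv.swap i (i + 1)) :
    ∀ n ≤ N, ∀ w ∈ Subgroup.closure (s '' Set.Iio n), π w = 1 → w = 1
  | 0, _, w, hw, _ => by simpa using hw
  | n + 1, hn, w, hw, hw1 => by
    obtain ⟨i, k, hik, v, hv, rfl⟩ := exists_run h hn hw
    have hfix : ∀ v ∈ Subgroup.closure (s '' Set.Iio n), π v (n + 1) = n + 1 := by
      intro v hv
      have hle : Subgroup.closure (s '' Set.Iio n) ≤
          (MulAction.stabilizer (Equiv.Perm ℕ) (n + 1)).comap π := by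
        rw [Subgroup.closure_le]
        rintro _ ⟨j, hj, rfl⟩
        have hj' : j < n := hj
        simp only [Subgroup.coe_comap, Set.mem_preimage, SetLike.mem_coe,
          MulAction.mem_stabilizer_iff, Equiv.Perm.smul_def]
        rw [hπ j (by omega), Equiv.swap_apply_of_ne_of_ne (by omega) (by omega)]
      simpa using hle hv
    have hrun : ∀ k i, i + k ≤ N → π (run s i k) (i + k) = i := by
      intro k
      induction k with
      | zero => simp [run]
      | succ k ih =>
        intro i hi
        have := ih (i + 1) (by omega)
        rw [run, map_mul, Equiv.Perm.mul_apply, show i + (k + 1) = i + 1 + k by omega, this,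
          hπ i (by omega), Equiv.swap_apply_right]
    have hi : i = n + 1 := by
      have := hrun k i (by omega)
      rw [hik] at this
      rw [← this, ← hfix v hv, ← Equiv.Perm.mul_apply, ← map_mul, hw1, hfix v hv]
      rfl
    obtain rfl : k = 0 := by omega
    rw [run, one_mul] at hw1 ⊢
    exact eq_one_of_map_eq_one h π hπ n (by omega) v hv hw1

/-- A section of a homomorphism onto a symmetric group over elements satisfying the Coxeter
relations. -/
theorem exists_section (h : IsCoxeterA s N) (π : G →* Equiv.Perm (Fin (N + 1)))
    (hπ : ∀ i : Fin N, π (s i) = Equiv.swap i.castSucc i.succ) :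
    ∃ ρ : Equiv.Perm (Fin (N + 1)) →* G, ∀ i : Fin N,
      ρ (Equiv.swap i.castSucc i.succ) = s i := by
  set P := Subgroup.closure (s '' Set.Iio N) with hP
  have hmem : ∀ i : Fin N, s i ∈ P := fun i => Subgroup.subset_closure ⟨i, i.2, rfl⟩
  let f : P →* Equiv.Perm (Fin (N + 1)) := π.comp P.subtype
  have hinj : Function.Injective f := by
    rw [injective_iff_map_eq_one]
    rintro ⟨w, hw⟩ hw1
    refine Subtype.ext (eq_one_of_map_eq_one h
      ((Equiv.Perm.viaEmbeddingHom Fin.valEmbedding).comp π) (fun i hi => ?_) N le_rfl w hw ?_)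
    · have := hπ ⟨i, hi⟩
      simp only [MonoidHom.comp_apply] at this ⊢
      rw [this]
      ext k
      by_cases hk : k < N + 1
      · have e : k = Fin.valEmbedding (⟨k, hk⟩ : Fin (N + 1)) := rfl
        rw [Equiv.Perm.viaEmbeddingHom_apply, e, Equiv.Perm.viaEmbedding_apply]
        simp only [Equiv.swap_apply_def, Fin.ext_iff, Fin.valEmbedding_apply, Fin.val_castSucc,
          Fin.val_succ]
        split_ifs <;> simp
      · rw [Equiv.Perm.viaEmbeddingHom_apply, Equiv.Perm.viaEmbedding_apply_of_notMem,
          Equiv.swap_apply_of_ne_of_ne]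
        · omega
        · omega
        · rintro ⟨x, rfl⟩
          exact hk x.2
    · have : π w = 1 := hw1
      rw [MonoidHom.comp_apply, this, map_one]
  have hsurj : Function.Surjective f := by
    rw [← MonoidHom.mrange_eq_top, eq_top_iff, ← Equiv.Perm.mclosure_swap_castSucc_succ,
      Submonoid.closure_le]
    rintro _ ⟨i, rfl⟩
    exact ⟨⟨s i, hmem i⟩, hπ i⟩
  let e := MulEquiv.ofBijective f ⟨hinj, hsurj⟩
  refine ⟨P.subtype.comp e.symm.toMonoidHom, fun i => ?_⟩
  have : e ⟨s i, hmem i⟩ = Equiv.swap i.castSucc i.succ := hπ i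
  rw [← this]
  simp

end IsCoxeterA

section Families

variable {G α : Type*} [Group G] [DecidableEq α]

/-- A family of involutions of `G` indexed by pairs of distinct points, compatible with a
homomorphism from the symmetric group in the way the reflections with a fixed displacement are. -/
structure IsReflFamily (ρ : Equiv.Perm α →* G) (X : α → α → G) : Prop where
  mul_self : ∀ {i j}, i ≠ j → X i j * X i j = 1
  equivariant : ∀ (τ : Equiv.Perm α) {i j}, i ≠ j → ρ τ * X i j * (ρ τ)⁻¹ = X (τ i) (τ j)
  right : ∀ {i j k}, i ≠ j → j ≠ k → i ≠ k → X i j * ρ (Equiv.swap j k) * X i j = X i k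
  left : ∀ {i j k}, i ≠ j → j ≠ k → i ≠ k → X i j * ρ (Equiv.swap i k) * X i j = X k j

theorem exists_perm_two {a b i j : α} (hab : a ≠ b) (hij : i ≠ j) :
    ∃ σ : Equiv.Perm α, σ a = i ∧ σ b = j := by
  refine ⟨Equiv.swap (Equiv.swap a i b) j * Equiv.swap a i, ?_, ?_⟩
  · rw [Equiv.Perm.mul_apply, Equiv.swap_apply_left, Equiv.swap_apply_of_ne_of_ne _ hij]
    intro h
    rw [eq_comm, Equiv.swap_apply_eq_iff, Equiv.swap_apply_right] at h
    exact hab h.symm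
  · rw [Equiv.Perm.mul_apply, Equiv.swap_apply_left]

theorem exists_perm_three {a b c i j k : α} (hab : a ≠ b) (hac : a ≠ c) (hbc : b ≠ c)
    (hij : i ≠ j) (hik : i ≠ k) (hjk : j ≠ k) :
    ∃ σ : Equiv.Perm α, σ a = i ∧ σ b = j ∧ σ c = k := by
  obtain ⟨σ, rfl, rfl⟩ := exists_perm_two hab hij
  exact ⟨Equiv.swap (σ c) k * σ,
    Equiv.swap_apply_of_ne_of_ne (σ.injective.ne hac) hik,
    Equiv.swap_apply_of_ne_of_ne (σ.injective.ne hbc) hjk, Equiv.swap_apply_left _ _⟩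

theorem exists_perm_four {a b c d i j k l : α} (hab : a ≠ b) (hac : a ≠ c) (had : a ≠ d)
    (hbc : b ≠ c) (hbd : b ≠ d) (hcd : c ≠ d) (hij : i ≠ j) (hik : i ≠ k) (hil : i ≠ l)
    (hjk : j ≠ k) (hjl : j ≠ l) (hkl : k ≠ l) :
    ∃ σ : Equiv.Perm α, σ a = i ∧ σ b = j ∧ σ c = k ∧ σ d = l := by
  obtain ⟨σ, rfl, rfl, rfl⟩ := exists_perm_three hab hac hbc hij hik hjk
  exact ⟨Equiv.swap (σ d) l * σ,
    Equiv.swap_apply_of_ne_of_ne (σ.injective.ne had) hil,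
    Equiv.swap_apply_of_ne_of_ne (σ.injective.ne hbd) hjl,
    Equiv.swap_apply_of_ne_of_ne (σ.injective.ne hcd) hkl, Equiv.swap_apply_left _ _⟩

theorem commute_map_of_commute_swap [Finite α] {ρ : Equiv.Perm α →* G} {u : G} {a b : α}
    (h : ∀ x y, x ≠ a → x ≠ b → y ≠ a → y ≠ b → Commute (ρ (Equiv.swap x y)) u)
    {σ : Equiv.Perm α} (ha : σ a = a) (hb : σ b = b) : Commute (ρ σ) u := by
  have key : ∀ τ : Equiv.Perm {x // x ≠ a ∧ x ≠ b}, Commute (ρ (Equiv.Perm.ofSubtype τ)) u := by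
    intro τ
    induction τ using Equiv.Perm.swap_induction_on with
    | one => simp
    | swap_mul f x y _ hf =>
      rw [map_mul, map_mul, Equiv.Perm.ofSubtype_swap_eq]
      exact (h x y x.2.1 x.2.2 y.2.1 y.2.2).mul_left hf
  have hσ : ∀ x, (x ≠ a ∧ x ≠ b) ↔ (σ x ≠ a ∧ σ x ≠ b) := fun x => by
    rw [← σ.injective.ne_iff (x := x) (y := a), ← σ.injective.ne_iff (x := x) (y := b), ha, hb]
  rw [← Equiv.Perm.ofSubtype_subtypePerm (p := fun x => x ≠ a ∧ x ≠ b) (f := σ) _ (fun x hx => ?_)]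
  · exact key _
  · exact fun x => (hσ x).symm
  · constructor
    · rintro rfl
      exact hx ha
    · rintro rfl
      exact hx hb

theorem commute_swap_trans {ρ : Equiv.Perm α →* G} {u : G} {x y z : α}
    (hxy : Commute (ρ (Equiv.swap x y)) u) (hyz : Commute (ρ (Equiv.swap y z)) u) :
    Commute (ρ (Equiv.swap x z)) u := by
  by_cases h1 : x = y
  · rwa [h1]
  by_cases h2 : x = z
  · rw [h2, Equiv.swap_self, ← Equiv.Perm.one_def, map_one]
    exact Commute.one_left u
  rw [Equiv.swap_comm x z, ← Equiv.swap_mul_swap_mul_swap h1 h2, map_mul, map_mul]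
  exact (hyz.mul_left hxy).mul_left hyz

theorem exists_isReflFamily [Finite α] {ρ : Equiv.Perm α →* G} {u : G} {a b c d : α} (hab : a ≠ b)
    (hac : a ≠ c) (hbc : b ≠ c) (had : a ≠ d) (hbd : b ≠ d) (hu : u * u = 1)
    (h : ∀ x y, x ≠ a → x ≠ b → y ≠ a → y ≠ b → Commute (ρ (Equiv.swap x y)) u)
    (hr : u * ρ (Equiv.swap b c) * u = ρ (Equiv.swap b c) * u * ρ (Equiv.swap b c))
    (hl : u * ρ (Equiv.swap a d) * u = ρ (Equiv.swap a d) * u * ρ (Equiv.swap a d)) :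
    ∃ X : α → α → G, IsReflFamily ρ X ∧ X a b = u := by
  classical
  let X : α → α → G := fun i j =>
    if h : ∃ σ : Equiv.Perm α, σ a = i ∧ σ b = j then ρ h.choose * u * (ρ h.choose)⁻¹ else 1
  have hX : ∀ σ : Equiv.Perm α, X (σ a) (σ b) = ρ σ * u * (ρ σ)⁻¹ := by
    intro σ
    have hex : ∃ τ : Equiv.Perm α, τ a = σ a ∧ τ b = σ b := ⟨σ, rfl, rfl⟩
    have hc := commute_map_of_commute_swap h (σ := σ⁻¹ * hex.choose)
      (by simp [hex.choose_spec.1]) (by simp [hex.choose_spec.2])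
    have : X (σ a) (σ b) = ρ hex.choose * u * (ρ hex.choose)⁻¹ := dif_pos hex
    have hc' := hc.eq
    rw [map_mul, map_inv, mul_assoc, inv_mul_eq_iff_eq_mul] at hc'
    rw [this, hc']
    group
  have hXab : X a b = u := by simpa using hX 1
  have heq : ∀ (τ : Equiv.Perm α) {i j}, i ≠ j → ρ τ * X i j * (ρ τ)⁻¹ = X (τ i) (τ j) := by
    intro τ i j hij
    obtain ⟨σ, rfl, rfl⟩ := exists_perm_two hab hij
    rw [hX, ← Equiv.Perm.mul_apply, ← Equiv.Perm.mul_apply, hX, map_mul]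
    group
  refine ⟨X, ⟨?_, heq, ?_, ?_⟩, hXab⟩
  · intro i j hij
    obtain ⟨σ, rfl, rfl⟩ := exists_perm_two hab hij
    rw [hX, show ρ σ * u * (ρ σ)⁻¹ * (ρ σ * u * (ρ σ)⁻¹) = ρ σ * (u * u) * (ρ σ)⁻¹ by group, hu]
    simp
  · intro i j k hij hjk hik
    obtain ⟨σ, rfl, rfl, rfl⟩ := exists_perm_three hab hac hbc hij hik hjk
    have h1 := hX (σ * Equiv.swap b c)
    simp only [Equiv.Perm.mul_apply, Equiv.swap_apply_left,
      Equiv.swap_apply_of_ne_of_ne hab hac] at h1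
    have h2 : (ρ (Equiv.swap b c))⁻¹ = ρ (Equiv.swap b c) := by rw [← map_inv, Equiv.swap_inv]
    rw [h1, hX, Equiv.swap_apply_apply, map_mul, map_mul, map_inv, mul_inv_rev, h2]
    calc _ = ρ σ * (u * ρ (Equiv.swap b c) * u) * (ρ σ)⁻¹ := by group
      _ = _ := by rw [hr]; group
  · intro i j k hij hjk hik
    obtain ⟨σ, rfl, rfl, rfl⟩ := exists_perm_three hab had hbd hij hik hjk
    have h1 := hX (σ * Equiv.swap a d)
    simp only [Equiv.Perm.mul_apply, Equiv.swap_apply_left,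
      Equiv.swap_apply_of_ne_of_ne hab.symm hbd] at h1
    have h2 : (ρ (Equiv.swap a d))⁻¹ = ρ (Equiv.swap a d) := by rw [← map_inv, Equiv.swap_inv]
    rw [h1, hX, Equiv.swap_apply_apply, map_mul, map_mul, map_inv, mul_inv_rev, h2]
    calc _ = ρ σ * (u * ρ (Equiv.swap a d) * u) * (ρ σ)⁻¹ := by group
      _ = _ := by rw [hl]; group

namespace IsReflFamily

variable {ρ : Equiv.Perm α →* G} {X : α → α → G}

theorem map_mul_eq (hX : IsReflFamily ρ X) (τ : Equiv.Perm α) {i j : α} (h : i ≠ j) :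
    ρ τ * X i j = X (τ i) (τ j) * ρ τ := by
  rw [← hX.equivariant τ h]
  group

theorem map_swap_mul_self (i j : α) : ρ (Equiv.swap i j) * ρ (Equiv.swap i j) = 1 := by
  rw [← map_mul, Equiv.swap_mul_self, map_one]

theorem swap_conj_right (hX : IsReflFamily ρ X) {i j k : α} (hij : i ≠ j)
    (hik : i ≠ k) : ρ (Equiv.swap j k) * X i j * ρ (Equiv.swap j k) = X i k := by
  rw [hX.map_mul_eq _ hij, mul_assoc, map_swap_mul_self, mul_one, Equiv.swap_apply_left,
    Equiv.swap_apply_of_ne_of_ne hij hik]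

/-- The translation obtained from a reflection by undoing its permutation. -/
theorem trans_mul_trans (hX : IsReflFamily ρ X) {i j k : α} (hij : i ≠ j) (hjk : j ≠ k)
    (hik : i ≠ k) : X i j * ρ (Equiv.swap i j) * (X j k * ρ (Equiv.swap j k)) =
      X i k * ρ (Equiv.swap i k) := by
  have h1 := hX.map_mul_eq (Equiv.swap i j) hjk
  rw [Equiv.swap_apply_right, Equiv.swap_apply_of_ne_of_ne hik.symm hjk.symm] at h1
  have h2 : X i j * X i k = ρ (Equiv.swap j k) * X i j := by
    rw [← hX.right hij hjk hik, ← mul_assoc, ← mul_assoc, hX.mul_self hij, one_mul]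
  have h3 := hX.map_mul_eq (Equiv.swap j k) hij
  rw [Equiv.swap_apply_left, Equiv.swap_apply_of_ne_of_ne hij hik] at h3
  calc _ = X i j * (ρ (Equiv.swap i j) * X j k) * ρ (Equiv.swap j k) := by simp only [mul_assoc]
    _ = (X i j * X i k) * ρ (Equiv.swap i j) * ρ (Equiv.swap j k) := by
      rw [h1]; simp only [mul_assoc]
    _ = X i k * (ρ (Equiv.swap j k) * ρ (Equiv.swap i j) * ρ (Equiv.swap j k)) := by
      rw [h2, h3]; simp only [mul_assoc]
    _ = _ := by
      rw [← map_mul, ← map_mul, Equiv.swap_mul_swap_mul_swap hij hik, Equiv.swap_comm k i]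

theorem trans_mul_trans' (hX : IsReflFamily ρ X) {i j k : α} (hij : i ≠ j) (hjk : j ≠ k)
    (hik : i ≠ k) : X j k * ρ (Equiv.swap j k) * (X i j * ρ (Equiv.swap i j)) =
      X i k * ρ (Equiv.swap i k) := by
  have h1 := hX.map_mul_eq (Equiv.swap j k) hij
  rw [Equiv.swap_apply_left, Equiv.swap_apply_of_ne_of_ne hij hik] at h1
  have h2 : X j k * X i k = ρ (Equiv.swap j i) * X j k := by
    rw [← hX.left hjk hik.symm hij.symm, ← mul_assoc, ← mul_assoc, hX.mul_self hjk, one_mul]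
  have h3 := hX.map_mul_eq (Equiv.swap j i) hjk
  rw [Equiv.swap_apply_left, Equiv.swap_apply_of_ne_of_ne hjk.symm hik.symm] at h3
  calc _ = X j k * (ρ (Equiv.swap j k) * X i j) * ρ (Equiv.swap i j) := by simp only [mul_assoc]
    _ = (X j k * X i k) * ρ (Equiv.swap j k) * ρ (Equiv.swap i j) := by
      rw [h1]; simp only [mul_assoc]
    _ = X i k * (ρ (Equiv.swap j i) * ρ (Equiv.swap k j) * ρ (Equiv.swap j i)) := by
      rw [h2, h3, Equiv.swap_comm i j, Equiv.swap_comm k j]; simp only [mul_assoc]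
    _ = _ := by
      rw [← map_mul, ← map_mul, Equiv.swap_mul_swap_mul_swap hjk.symm hik.symm]

theorem trans_mul_symm (hX : IsReflFamily ρ X) {i j : α} (hij : i ≠ j) :
    X i j * ρ (Equiv.swap i j) * (X j i * ρ (Equiv.swap j i)) = 1 := by
  have h1 := hX.map_mul_eq (Equiv.swap i j) hij.symm
  rw [Equiv.swap_apply_left, Equiv.swap_apply_right] at h1
  rw [mul_assoc, ← mul_assoc (ρ _), h1, Equiv.swap_comm j i, mul_assoc, map_swap_mul_self, mul_one,
    hX.mul_self hij]

end IsReflFamily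

end Families

namespace Heis

/-- The edge of `T` joining the triangles labelled `n` and `n + 1`. -/
def pathEdge (n : ℕ) : ET :=
  if n % 6 = 5 then (((n / 6 : ℕ), (n / 6 : ℕ) + 1), 2)
  else (((n / 6 : ℕ) + 2 - (n % 6 / 2 : ℕ), (n / 6 : ℕ)), if n % 2 = 0 then 0 else 1)

theorem pathEdge_ends (n : Fin 17) : disp (pathEdge n) = 0 ∧
    (pos (endA (pathEdge n)) = n.castSucc ∧ pos (endB (pathEdge n)) = n.succ ∨
      pos (endA (pathEdge n)) = n.succ ∧ pos (endB (pathEdge n)) = n.castSucc) := by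
  revert n
  decide

theorem exists_pathEdge_eq (e : ET) (h : disp e = 0) : ∃ n : Fin 17, pathEdge n = e := by
  revert e
  decide

theorem ofC_pathEdge (n : Fin 17) :
    ofC (uC (pathEdge n)) = SemidirectProduct.inr (Equiv.swap n.castSucc n.succ) := by
  obtain ⟨h0, h | h⟩ := pathEdge_ends n
  · rw [ofC_uC, edgeRefl, h0, refl_zero, h.1, h.2]
  · rw [ofC_uC, edgeRefl, h0, refl_zero, h.1, h.2, Equiv.swap_comm]

theorem isCoxeterA_pathEdge : IsCoxeterA (fun n => uC (pathEdge n)) 17 where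
  sq _ _ := uC_mul_self _
  comm i j hij hj := by
    have key : ∀ i j : Fin 17, i.val + 1 < j.val →
        endA (pathEdge i) ≠ endA (pathEdge j) ∧ endA (pathEdge i) ≠ endB (pathEdge j) ∧
        endB (pathEdge i) ≠ endA (pathEdge j) ∧ endB (pathEdge i) ≠ endB (pathEdge j) := by
      decide
    exact uC_commute_of_disjoint (key ⟨i, by omega⟩ ⟨j, hj⟩ hij)
  braid i hi := by
    have key : ∀ i : Fin 16, pathEdge i ≠ pathEdge (i + 1) ∧
        (endA (pathEdge i) = endA (pathEdge (i + 1)) ∨ endA (pathEdge i) = endB (pathEdge (i + 1)) ∨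
        endB (pathEdge i) = endA (pathEdge (i + 1)) ∨
        endB (pathEdge i) = endB (pathEdge (i + 1))) := by
      decide
    have := key ⟨i, by omega⟩
    exact uC_braid_of_meet this.1 this.2

theorem exists_rho : ∃ ρ : Equiv.Perm (Fin 18) →* Cgrp, ∀ n : Fin 17,
    ρ (Equiv.swap n.castSucc n.succ) = uC (pathEdge n) :=
  isCoxeterA_pathEdge.exists_section (SemidirectProduct.rightHom.comp ofC) fun n => by
    rw [MonoidHom.comp_apply, ofC_pathEdge, SemidirectProduct.rightHom_inr]

/-- The symmetric group inside `C` generated by the edges of the Hamiltonian path. -/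
noncomputable def rho : Equiv.Perm (Fin 18) →* Cgrp := exists_rho.choose

theorem rho_swap (n : Fin 17) : rho (Equiv.swap n.castSucc n.succ) = uC (pathEdge n) :=
  exists_rho.choose_spec n

theorem ofC_rho (σ : Equiv.Perm (Fin 18)) : ofC (rho σ) = SemidirectProduct.inr σ := by
  have : ofC.comp rho = SemidirectProduct.inr := by
    refine MonoidHom.eq_of_eqOn_denseM (Equiv.Perm.mclosure_swap_castSucc_succ 17) ?_
    rintro _ ⟨n, rfl⟩
    rw [MonoidHom.comp_apply, rho_swap, ofC_pathEdge]
  exact DFunLike.congr_fun this σ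

theorem uC_eq_rho {e : ET} (h : disp e = 0) :
    uC e = rho (Equiv.swap (pos (endA e)) (pos (endB e))) := by
  obtain ⟨n, rfl⟩ := exists_pathEdge_eq e h
  obtain ⟨-, h | h⟩ := pathEdge_ends n
  · rw [h.1, h.2, rho_swap]
  · rw [h.1, h.2, Equiv.swap_comm, rho_swap]

theorem commute_rho_swap {e : ET} (n : Fin 17) (hA : n.castSucc ≠ pos (endA e))
    (hB : n.castSucc ≠ pos (endB e)) (hA' : n.succ ≠ pos (endA e)) (hB' : n.succ ≠ pos (endB e)) :
    Commute (rho (Equiv.swap n.castSucc n.succ)) (uC e) := by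
  rw [rho_swap]
  refine uC_commute_of_disjoint ?_
  obtain ⟨-, h | h⟩ := pathEdge_ends n <;>
    refine ⟨fun h' => ?_, fun h' => ?_, fun h' => ?_, fun h' => ?_⟩ <;>
    simp_all

theorem commute_rho_swap_chain {u : Cgrp} {m : ℕ} : ∀ (n : ℕ) (hmn : m ≤ n) (hn : n < 18),
    (∀ k : Fin 17, m ≤ k → k < n → Commute (rho (Equiv.swap k.castSucc k.succ)) u) →
    Commute (rho (Equiv.swap ⟨m, by omega⟩ ⟨n, hn⟩)) u := by
  intro n hmn
  induction n, hmn using Nat.le_induction with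
  | base =>
    intro _ _
    rw [Equiv.swap_self, ← Equiv.Perm.one_def, map_one]
    exact Commute.one_left u
  | succ n hmn ih =>
    intro hn h
    exact commute_swap_trans (ih (by omega) fun k hk hk' => h k hk (by omega))
      (h ⟨n, by omega⟩ hmn (by simp))

theorem rho_swap_conj {i j k : Fin 18} (hjk : j ≠ k) (hik : i ≠ k) :
    rho (Equiv.swap i j) * rho (Equiv.swap j k) * rho (Equiv.swap i j) =
      rho (Equiv.swap i k) := by
  rw [← map_mul, ← map_mul, Equiv.swap_comm i j, Equiv.swap_comm j k,
    Equiv.swap_mul_swap_mul_swap hjk.symm hik.symm]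

theorem exists_family_left : ∃ X : Fin 18 → Fin 18 → Cgrp, IsReflFamily rho X ∧
    X 5 0 = uC ((0, 0), 1) := by
  have hfork : Commute (rho (Equiv.swap 4 6)) (uC ((0, 0), 1)) := by
    have h := uC_hexagon_eq (1, 1) 3
    have h3 : uC (hexEdge (1, 1) 3) = rho (Equiv.swap 6 5) := uC_eq_rho rfl
    have h4 : uC (hexEdge (1, 1) (3 + 1)) = rho (Equiv.swap 4 5) := uC_eq_rho rfl
    have h46 : rho (Equiv.swap 4 6) = rho (Equiv.swap 4 5) * rho (Equiv.swap 6 5) *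
        rho (Equiv.swap 4 5) := by
      rw [Equiv.swap_comm 6 5]
      exact (rho_swap_conj (by decide) (by decide)).symm
    have h1 : uC (hexEdge (1, 1) (3 + 1)) * uC (hexEdge (1, 1) (3 + 1)) = 1 := uC_mul_self _
    rw [h46, ← h3, ← h4, h]
    simp only [← mul_assoc, h1, one_mul]
    simp only [mul_assoc, h1, mul_one]
    have hc : ∀ k : Fin 6, k = 0 ∨ k = 1 ∨ k = 2 ∨ k = 5 →
        Commute (uC (hexEdge (1, 1) k)) (uC ((0, 0), 1)) := by
      have : ∀ k : Fin 6, k = 0 ∨ k = 1 ∨ k = 2 ∨ k = 5 →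
          endA (hexEdge (1, 1) k) ≠ endA ((0, 0), 1) ∧ endA (hexEdge (1, 1) k) ≠ endB ((0, 0), 1) ∧
          endB (hexEdge (1, 1) k) ≠ endA ((0, 0), 1) ∧
          endB (hexEdge (1, 1) k) ≠ endB ((0, 0), 1) := by
        decide
      exact fun k hk => uC_commute_of_disjoint (this k hk)
    have c2 := hc (3 + 2) (by decide)
    have c3 := hc (3 + 3) (by decide)
    have c4 := hc (3 + 4) (by decide)
    have c5 := hc (3 + 5) (by decide)
    exact c2.mul_left (c3.mul_left (c4.mul_left (c5.mul_left (c4.mul_left (c3.mul_left c2)))))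
  have key : ∀ x : Fin 18, x ≠ 5 → x ≠ 0 →
      Commute (rho (Equiv.swap x 6)) (uC ((0, 0), 1)) := by
    intro x h5 h0
    rw [Fin.ne_iff_vne] at h5 h0
    change x.val ≠ 5 at h5
    change x.val ≠ 0 at h0
    have hpath : ∀ k : Fin 17, k.val ≠ 0 → k.val ≠ 4 → k.val ≠ 5 →
        Commute (rho (Equiv.swap k.castSucc k.succ)) (uC ((0, 0), 1)) := by
      intro k hk0 hk4 hk5
      refine commute_rho_swap k ?_ ?_ ?_ ?_ <;> intro h <;> rw [Fin.ext_iff] at h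
      · exact hk5 h
      · exact hk0 h
      · exact hk4 (Nat.succ_injective h)
      · exact Nat.succ_ne_zero _ h
    rcases Nat.lt_or_gt_of_ne h5 with h | h
    · refine commute_swap_trans (y := 4) ?_ hfork
      exact commute_rho_swap_chain 4 (by omega) (by omega) fun k _ _ =>
        hpath k (by omega) (by omega) (by omega)
    · rw [Equiv.swap_comm]
      exact commute_rho_swap_chain (m := 6) x (by omega) x.2 fun k _ _ =>
        hpath k (by omega) (by omega) (by omega)
  have h01 : uC ((2, 0), 0) = rho (Equiv.swap 0 1) := uC_eq_rho rfl
  have h45 : uC ((0, 0), 0) = rho (Equiv.swap 5 4) := by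
    rw [Equiv.swap_comm]; exact uC_eq_rho rfl
  refine exists_isReflFamily (a := 5) (b := 0) (c := 1) (d := 4) (by decide) (by decide)
    (by decide) (by decide) (by decide) (uC_mul_self _) (fun x y hx hx' hy hy' => ?_) ?_ ?_
  · refine commute_swap_trans (key x hx hx') ?_
    rw [Equiv.swap_comm]
    exact key y hy hy'
  · rw [← h01]
    exact uC_braid_of_meet (by decide) (by decide)
  · rw [← h45]
    exact uC_braid_of_meet (by decide) (by decide)

theorem exists_family_bottom : ∃ Y : Fin 18 → Fin 18 → Cgrp, IsReflFamily rho Y ∧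
    Y 0 17 = uC ((2, 0), 2) := by
  have key : ∀ x : Fin 18, x ≠ 0 → x ≠ 17 →
      Commute (rho (Equiv.swap 1 x)) (uC ((2, 0), 2)) := by
    intro x h0 h17
    rw [Fin.ne_iff_vne] at h0 h17
    change x.val ≠ 0 at h0
    change x.val ≠ 17 at h17
    refine commute_rho_swap_chain (m := 1) x (by omega) x.2 fun k hk hk' =>
      commute_rho_swap k ?_ ?_ ?_ ?_ <;> intro h <;> rw [Fin.ext_iff] at h
    · change k.val = 0 at h
      omega
    · change k.val = 17 at h
      omega
    · exact Nat.succ_ne_zero _ h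
    · change k.val + 1 = 17 at h
      omega
  have h01 : uC ((2, 0), 0) = rho (Equiv.swap 0 1) := uC_eq_rho rfl
  have h1617 : uC ((2, 2), 0) = rho (Equiv.swap 17 16) := by
    rw [Equiv.swap_comm]; exact uC_eq_rho rfl
  refine exists_isReflFamily (a := 0) (b := 17) (c := 16) (d := 1) (by decide) (by decide)
    (by decide) (by decide) (by decide) (uC_mul_self _) (fun x y hx hx' hy hy' => ?_) ?_ ?_
  · refine commute_swap_trans (y := 1) ?_ (key y hy hy')
    rw [Equiv.swap_comm]
    exact key x hx hx'
  · rw [← h1617]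
    exact uC_braid_of_meet (by decide) (by decide)
  · rw [← h01]
    exact uC_braid_of_meet (by decide) (by decide)

theorem uC_hexagon_of_eq (p : ZMod 3 × ZMod 3) (k : Fin 6) {a b c d e : Cgrp}
    (h1 : uC (hexEdge p (k + 1)) = a) (h2 : uC (hexEdge p (k + 2)) = b)
    (h3 : uC (hexEdge p (k + 3)) = c) (h4 : uC (hexEdge p (k + 4)) = d)
    (h5 : uC (hexEdge p (k + 5)) = e) :
    uC (hexEdge p k) = a * (b * (c * (d * e * d) * c) * b) * a := by
  rw [uC_hexagon_eq, h1, h2, h3, h4, h5]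

theorem left_chords {X : Fin 18 → Fin 18 → Cgrp} (hX : IsReflFamily rho X)
    (h50 : uC ((0, 0), 1) = X 5 0) :
    uC ((2, 1), 2) = X 8 1 ∧ uC ((1, 1), 2) = X 10 3 ∧ uC ((1, 1), 1) = X 11 6 ∧
      uC ((0, 2), 2) = X 14 7 ∧ uC ((2, 2), 2) = X 16 9 ∧ uC ((2, 2), 1) = X 17 12 := by
  have h81 : uC ((2, 1), 2) = X 8 1 := by
    have h : uC ((2, 1), 2) = rho (Equiv.swap 0 1) * (X 5 0 * (rho (Equiv.swap 6 5) *
        (rho (Equiv.swap 6 7) * rho (Equiv.swap 7 8) * rho (Equiv.swap 6 7)) *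
        rho (Equiv.swap 6 5)) * X 5 0) * rho (Equiv.swap 0 1) :=
      uC_hexagon_of_eq (0, 1) 3 (uC_eq_rho rfl) h50 (uC_eq_rho rfl) (uC_eq_rho rfl) (uC_eq_rho rfl)
    rw [h, rho_swap_conj (by decide) (by decide), Equiv.swap_comm 6 5,
      rho_swap_conj (by decide) (by decide), hX.left (by decide) (by decide) (by decide),
      hX.swap_conj_right (by decide) (by decide)]
  have h103 : uC ((1, 1), 2) = X 10 3 := by
    have h : uC ((1, 1), 2) = rho (Equiv.swap 2 3) * (rho (Equiv.swap 1 2) * (X 8 1 *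
        (rho (Equiv.swap 8 9) * rho (Equiv.swap 9 10) * rho (Equiv.swap 8 9)) *
        X 8 1) * rho (Equiv.swap 1 2)) * rho (Equiv.swap 2 3) :=
      uC_hexagon_of_eq (2, 1) 3 (uC_eq_rho rfl) (uC_eq_rho rfl) h81 (uC_eq_rho rfl) (uC_eq_rho rfl)
    rw [h, rho_swap_conj (by decide) (by decide), hX.left (by decide) (by decide) (by decide),
      hX.swap_conj_right (by decide) (by decide), hX.swap_conj_right (by decide) (by decide)]
  have h116 : uC ((1, 1), 1) = X 11 6 := by
    have h : uC ((1, 1), 1) = rho (Equiv.swap 6 5) * (rho (Equiv.swap 4 5) *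
        (rho (Equiv.swap 3 4) * (X 10 3 * rho (Equiv.swap 10 11) * X 10 3) *
        rho (Equiv.swap 3 4)) * rho (Equiv.swap 4 5)) * rho (Equiv.swap 6 5) :=
      uC_hexagon_of_eq (1, 1) 2 (uC_eq_rho rfl) (uC_eq_rho rfl) (uC_eq_rho rfl) h103
        (uC_eq_rho rfl)
    rw [h, hX.left (by decide) (by decide) (by decide),
      hX.swap_conj_right (by decide) (by decide), hX.swap_conj_right (by decide) (by decide),
      Equiv.swap_comm 6 5, hX.swap_conj_right (by decide) (by decide)]
  have h147 : uC ((0, 2), 2) = X 14 7 := by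
    have h : uC ((0, 2), 2) = rho (Equiv.swap 6 7) * (X 11 6 * (rho (Equiv.swap 12 11) *
        (rho (Equiv.swap 12 13) * rho (Equiv.swap 13 14) * rho (Equiv.swap 12 13)) *
        rho (Equiv.swap 12 11)) * X 11 6) * rho (Equiv.swap 6 7) :=
      uC_hexagon_of_eq (1, 2) 3 (uC_eq_rho rfl) h116 (uC_eq_rho rfl) (uC_eq_rho rfl) (uC_eq_rho rfl)
    rw [h, rho_swap_conj (by decide) (by decide), Equiv.swap_comm 12 11,
      rho_swap_conj (by decide) (by decide), hX.left (by decide) (by decide) (by decide),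
      hX.swap_conj_right (by decide) (by decide)]
  have h169 : uC ((2, 2), 2) = X 16 9 := by
    have h : uC ((2, 2), 2) = rho (Equiv.swap 8 9) * (rho (Equiv.swap 7 8) * (X 14 7 *
        (rho (Equiv.swap 14 15) * rho (Equiv.swap 15 16) * rho (Equiv.swap 14 15)) *
        X 14 7) * rho (Equiv.swap 7 8)) * rho (Equiv.swap 8 9) :=
      uC_hexagon_of_eq (0, 2) 3 (uC_eq_rho rfl) (uC_eq_rho rfl) h147 (uC_eq_rho rfl)
        (uC_eq_rho rfl)
    rw [h, rho_swap_conj (by decide) (by decide), hX.left (by decide) (by decide) (by decide),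
      hX.swap_conj_right (by decide) (by decide), hX.swap_conj_right (by decide) (by decide)]
  have h1712 : uC ((2, 2), 1) = X 17 12 := by
    have h : uC ((2, 2), 1) = rho (Equiv.swap 12 11) * (rho (Equiv.swap 10 11) *
        (rho (Equiv.swap 9 10) * (X 16 9 * rho (Equiv.swap 16 17) * X 16 9) *
        rho (Equiv.swap 9 10)) * rho (Equiv.swap 10 11)) * rho (Equiv.swap 12 11) :=
      uC_hexagon_of_eq (2, 2) 2 (uC_eq_rho rfl) (uC_eq_rho rfl) (uC_eq_rho rfl) h169
        (uC_eq_rho rfl)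
    rw [h, hX.left (by decide) (by decide) (by decide),
      hX.swap_conj_right (by decide) (by decide), hX.swap_conj_right (by decide) (by decide),
      Equiv.swap_comm 12 11, hX.swap_conj_right (by decide) (by decide)]
  exact ⟨h81, h103, h116, h147, h169, h1712⟩

theorem swap_conj_triple {X Y : Fin 18 → Fin 18 → Cgrp} (hX : IsReflFamily rho X)
    (hY : IsReflFamily rho Y) (τ : Equiv.Perm (Fin 18)) {i j k l : Fin 18} (hij : i ≠ j)
    (hkl : k ≠ l) :
    rho τ * (X i j * Y k l * X i j) * (rho τ)⁻¹ =
      X (τ i) (τ j) * Y (τ k) (τ l) * X (τ i) (τ j) := by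
  rw [← hX.equivariant τ hij, ← hY.equivariant τ hkl]
  group

theorem rho_swap_inv (i j : Fin 18) : (rho (Equiv.swap i j))⁻¹ = rho (Equiv.swap i j) := by
  rw [← map_inv, Equiv.swap_inv]

theorem rho_swap_commute {X : Fin 18 → Fin 18 → Cgrp} (hX : IsReflFamily rho X)
    {i j k l : Fin 18} (hij : i ≠ j) (hik : i ≠ k) (hil : i ≠ l) (hjk : j ≠ k) (hjl : j ≠ l) :
    X i j * rho (Equiv.swap k l) = rho (Equiv.swap k l) * X i j := by
  rw [hX.map_mul_eq _ hij, Equiv.swap_apply_of_ne_of_ne hik hil,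
    Equiv.swap_apply_of_ne_of_ne hjk hjl]

theorem exists_families : ∃ X Y : Fin 18 → Fin 18 → Cgrp,
    IsReflFamily rho X ∧ IsReflFamily rho Y ∧
    (∀ {i j k l : Fin 18}, i ≠ j → i ≠ k → i ≠ l → j ≠ k → j ≠ l → k ≠ l →
      Commute (X i j) (Y k l)) ∧
    (∀ {i j k l : Fin 18}, i ≠ j → i ≠ k → i ≠ l → j ≠ k → j ≠ l → k ≠ l →
      X i j * Y j k * X i j = Y i l * X l k * Y i l) ∧
    X 5 0 = uC ((0, 0), 1) ∧ Y 0 17 = uC ((2, 0), 2) ∧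
    ∀ e, (∃ σ, uC e = rho σ) ∨ (∃ i j, i ≠ j ∧ uC e = X i j) ∨ (∃ i j, i ≠ j ∧ uC e = Y i j) ∨
      ∃ i j k, i ≠ j ∧ j ≠ k ∧ uC e = X i j * Y j k * X i j := by
  obtain ⟨X, hX, h50⟩ := exists_family_left
  obtain ⟨Y, hY, h017⟩ := exists_family_bottom
  obtain ⟨h81, h103, h116, h147, h169, h1712⟩ := left_chords hX h50.symm
  have h415 : uC ((0, 0), 2) = X 4 0 * Y 0 15 * X 4 0 := by
    have h : uC ((0, 0), 2) = rho (Equiv.swap 4 5) * (X 5 0 * (Y 0 17 *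
        (rho (Equiv.swap 16 17) * rho (Equiv.swap 15 16) * rho (Equiv.swap 16 17)) *
        Y 0 17) * X 5 0) * rho (Equiv.swap 4 5) :=
      uC_hexagon_of_eq (0, 0) 0 (uC_eq_rho rfl) h50.symm h017.symm (uC_eq_rho rfl) (uC_eq_rho rfl)
    have h2 := swap_conj_triple hX hY (Equiv.swap 4 5) (i := 5) (j := 0) (k := 0) (l := 15)
      (by decide) (by decide)
    rw [rho_swap_inv] at h2
    rw [h, Equiv.swap_comm 16 17, Equiv.swap_comm 15 16, rho_swap_conj (by decide) (by decide),
      hY.right (by decide) (by decide) (by decide), h2]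
    rfl
  have h213 : uC ((1, 0), 2) = X 2 0 * Y 0 13 * X 2 0 := by
    have h : uC ((1, 0), 2) = rho (Equiv.swap 2 3) * (rho (Equiv.swap 3 4) *
        (X 4 0 * Y 0 15 * X 4 0 * (rho (Equiv.swap 14 15) * rho (Equiv.swap 13 14) *
        rho (Equiv.swap 14 15)) * (X 4 0 * Y 0 15 * X 4 0)) *
        rho (Equiv.swap 3 4)) * rho (Equiv.swap 2 3) :=
      uC_hexagon_of_eq (1, 0) 0 (uC_eq_rho rfl) (uC_eq_rho rfl) h415 (uC_eq_rho rfl)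
        (uC_eq_rho rfl)
    have h2 := swap_conj_triple hX hY (Equiv.swap 3 4) (i := 4) (j := 0) (k := 0) (l := 13)
      (by decide) (by decide)
    have h3 := swap_conj_triple hX hY (Equiv.swap 2 3) (i := 3) (j := 0) (k := 0) (l := 13)
      (by decide) (by decide)
    rw [rho_swap_inv] at h2 h3
    have h4 : X 4 0 * Y 0 15 * X 4 0 * rho (Equiv.swap 15 13) * (X 4 0 * Y 0 15 * X 4 0) =
        X 4 0 * Y 0 13 * X 4 0 := calc
      _ = X 4 0 * Y 0 15 * (X 4 0 * rho (Equiv.swap 15 13)) * X 4 0 * Y 0 15 * X 4 0 := by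
        simp only [mul_assoc]
      _ = X 4 0 * Y 0 15 * rho (Equiv.swap 15 13) * (X 4 0 * X 4 0) * Y 0 15 * X 4 0 := by
        rw [rho_swap_commute hX (by decide) (by decide) (by decide) (by decide) (by decide)]
        simp only [mul_assoc]
      _ = X 4 0 * (Y 0 15 * rho (Equiv.swap 15 13) * Y 0 15) * X 4 0 := by
        rw [hX.mul_self (by decide), mul_one]
        simp only [mul_assoc]
      _ = _ := by rw [hY.right (by decide) (by decide) (by decide)]
    rw [h, Equiv.swap_comm 14 15, Equiv.swap_comm 13 14, rho_swap_conj (by decide) (by decide), h4,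
      h2]
    exact h3
  have h213' : uC ((1, 0), 2) = X 17 13 * Y 2 17 * X 17 13 := by
    have h : uC ((1, 0), 2) = rho (Equiv.swap 12 13) * (X 17 12 * (Y 0 17 *
        (rho (Equiv.swap 0 1) * rho (Equiv.swap 1 2) * rho (Equiv.swap 0 1)) *
        Y 0 17) * X 17 12) * rho (Equiv.swap 12 13) :=
      uC_hexagon_of_eq (2, 0) 3 (uC_eq_rho rfl) h1712 h017.symm (uC_eq_rho rfl) (uC_eq_rho rfl)
    have h2 := swap_conj_triple hX hY (Equiv.swap 12 13) (i := 17) (j := 12) (k := 2) (l := 17)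
      (by decide) (by decide)
    rw [rho_swap_inv] at h2
    rw [h, rho_swap_conj (by decide) (by decide), hY.left (by decide) (by decide) (by decide)]
    exact h2
  have hbraid : X 17 12 * Y 0 17 * X 17 12 = Y 0 17 * X 17 12 * Y 0 17 := by
    rw [← h1712, h017]
    exact uC_braid_of_meet (by decide) (by decide)
  have hbraid' : X 17 13 * Y 2 17 * X 17 13 = Y 2 17 * X 17 13 * Y 2 17 := by
    obtain ⟨σ, h1, h2, h3⟩ := exists_perm_three (show (0 : Fin 18) ≠ 12 by decide)
      (show (0 : Fin 18) ≠ 17 by decide) (show (12 : Fin 18) ≠ 17 by decide)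
      (show (2 : Fin 18) ≠ 13 by decide) (show (2 : Fin 18) ≠ 17 by decide)
      (show (13 : Fin 18) ≠ 17 by decide)
    have e1 := swap_conj_triple hX hY σ (i := 17) (j := 12) (k := 0) (l := 17)
      (by decide) (by decide)
    have e2 := swap_conj_triple hY hX σ (i := 0) (j := 17) (k := 17) (l := 12)
      (by decide) (by decide)
    rw [h1, h2, h3] at e1 e2
    rw [← e1, ← e2, hbraid]
  refine ⟨X, Y, hX, hY, ?_, ?_, h50, h017, ?_⟩
  · intro i j k l hij hik hil hjk hjl hkl
    have h : X 8 1 * Y 0 17 = Y 0 17 * X 8 1 := by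
      rw [← h81, h017]
      exact uC_commute_of_disjoint (by decide)
    obtain ⟨σ, rfl, rfl, rfl, rfl⟩ := exists_perm_four (show (8 : Fin 18) ≠ 1 by decide)
      (show (8 : Fin 18) ≠ 0 by decide) (show (8 : Fin 18) ≠ 17 by decide)
      (show (1 : Fin 18) ≠ 0 by decide) (show (1 : Fin 18) ≠ 17 by decide)
      (show (0 : Fin 18) ≠ 17 by decide) hij hik hil hjk hjl hkl
    rw [← hX.equivariant σ (by decide), ← hY.equivariant σ (by decide)]
    exact (Commute.conj_iff (rho σ)).2 h
  · intro i j k l hij hik hil hjk hjl hkl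
    have h : X 2 0 * Y 0 13 * X 2 0 = Y 2 17 * X 17 13 * Y 2 17 := by
      rw [← h213, h213', hbraid']
    obtain ⟨σ, rfl, rfl, rfl, rfl⟩ := exists_perm_four (show (2 : Fin 18) ≠ 0 by decide)
      (show (2 : Fin 18) ≠ 13 by decide) (show (2 : Fin 18) ≠ 17 by decide)
      (show (0 : Fin 18) ≠ 13 by decide) (show (0 : Fin 18) ≠ 17 by decide)
      (show (13 : Fin 18) ≠ 17 by decide) hij hik hil hjk hjl hkl
    rw [← swap_conj_triple hX hY σ (by decide) (by decide), h,
      swap_conj_triple hY hX σ (by decide) (by decide)]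
  · intro e
    have hcases : ∀ e : ET, disp e = 0 ∨ e = ((0, 0), 1) ∨ e = ((2, 1), 2) ∨ e = ((1, 1), 2) ∨
        e = ((1, 1), 1) ∨ e = ((0, 2), 2) ∨ e = ((2, 2), 2) ∨ e = ((2, 2), 1) ∨
        e = ((2, 0), 2) ∨ e = ((0, 0), 2) ∨ e = ((1, 0), 2) := by
      decide
    rcases hcases e with h | rfl | rfl | rfl | rfl | rfl | rfl | rfl | rfl | rfl | rfl
    · exact Or.inl ⟨_, uC_eq_rho h⟩
    · exact Or.inr (Or.inl ⟨_, _, by decide, h50.symm⟩)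
    · exact Or.inr (Or.inl ⟨_, _, by decide, h81⟩)
    · exact Or.inr (Or.inl ⟨_, _, by decide, h103⟩)
    · exact Or.inr (Or.inl ⟨_, _, by decide, h116⟩)
    · exact Or.inr (Or.inl ⟨_, _, by decide, h147⟩)
    · exact Or.inr (Or.inl ⟨_, _, by decide, h169⟩)
    · exact Or.inr (Or.inl ⟨_, _, by decide, h1712⟩)
    · exact Or.inr (Or.inr (Or.inl ⟨_, _, by decide, h017.symm⟩))
    · exact Or.inr (Or.inr (Or.inr ⟨_, _, _, by decide, by decide, h415⟩))
    · exact Or.inr (Or.inr (Or.inr ⟨_, _, _, by decide, by decide, h213⟩))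

end Heis

section Translations

open scoped commutatorElement

variable {G α : Type*} [Group G]

theorem commutator_mul_right_of_commute {a c : G} (h : Commute a c) (b : G) :
    ⁅a, b * c⁆ = ⁅a, b⁆ := by
  rw [commutatorElement_def, commutatorElement_def, mul_inv_rev,
    show a * (b * c) * a⁻¹ * (c⁻¹ * b⁻¹) = a * b * (c * a⁻¹) * c⁻¹ * b⁻¹ by group,
    h.symm.inv_right.eq]
  group

theorem commutator_mul_right_of_commute' {a c : G} (h : Commute a c) (b : G) :
    ⁅a, c * b⁆ = c * ⁅a, b⁆ * c⁻¹ := by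
  rw [commutatorElement_def, commutatorElement_def, mul_inv_rev, ← mul_assoc a, h.eq]
  group

theorem commutator_mul_left_of_commute {b c : G} (h : Commute c b) (a : G) :
    ⁅a * c, b⁆ = ⁅a, b⁆ := by
  rw [← commutatorElement_inv, commutator_mul_right_of_commute h.symm, commutatorElement_inv]

theorem commutator_mul_left_of_commute' {b c : G} (h : Commute c b) (a : G) :
    ⁅c * a, b⁆ = c * ⁅a, b⁆ * c⁻¹ := by
  rw [← commutatorElement_inv, commutator_mul_right_of_commute' h.symm,
    ← commutatorElement_inv a b]
  group

/-- A commuting family of elements indexed by pairs of points, additive along paths. -/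
structure IsTransFamily (p : α → α → G) : Prop where
  mul : ∀ i j k, p i j * p j k = p i k
  mul' : ∀ i j k, p j k * p i j = p i k

namespace IsTransFamily

variable {p q : α → α → G}

theorem self (hp : IsTransFamily p) (i : α) : p i i = 1 :=
  mul_eq_left.mp (hp.mul i i i)

theorem inv (hp : IsTransFamily p) (i j : α) : (p i j)⁻¹ = p j i :=
  inv_eq_of_mul_eq_one_right ((hp.mul i j i).trans (hp.self i))

theorem commute (hp : IsTransFamily p) (i j k l : α) : Commute (p i j) (p k l) := by
  have h : ∀ a b c, Commute (p a b) (p b c) := fun a b c =>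
    (hp.mul a b c).trans (hp.mul' a b c).symm
  have h' : ∀ a b c, Commute (p a b) (p a c) := fun a b c => by
    rw [← hp.mul a b c]
    exact (Commute.refl _).mul_right (h a b c)
  rw [← hp.mul k i l]
  exact (h k i j).symm.mul_right (h' i j l)

/-- The commutator of `p i j` and `q i k` depends only on `i`. -/
theorem exists_commutator (hp : IsTransFamily p) (hq : IsTransFamily q)
    (hα : ∀ s : Finset α, s.card ≤ 5 → ∃ x, x ∉ s)
    (hpq : ∀ {i j k l}, i ≠ j → i ≠ k → i ≠ l → j ≠ k → j ≠ l → k ≠ l →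
      Commute (p i j) (q k l)) :
    ∃ z : α → G, (∀ {i j k}, i ≠ j → i ≠ k → j ≠ k → ⁅p i j, q i k⁆ = z i) ∧
      (∀ {i j k}, i ≠ j → i ≠ k → Commute (p j k) (z i)) ∧
      ∀ {i j k}, i ≠ j → i ≠ k → Commute (q j k) (z i) := by
  classical
  have hk : ∀ {i j k l}, i ≠ j → i ≠ k → i ≠ l → j ≠ k → j ≠ l → k ≠ l →
      ⁅p i j, q i l⁆ = ⁅p i j, q i k⁆ ∧ Commute (q k l) ⁅p i j, q i k⁆ := by
    intro i j k l h1 h2 h3 h4 h5 h6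
    have hc := hpq h1 h2 h3 h4 h5 h6
    have e1 := commutator_mul_right_of_commute hc (q i k)
    have e2 := commutator_mul_right_of_commute' hc (q i k)
    rw [hq.mul] at e1
    rw [hq.mul', e1, eq_mul_inv_iff_mul_eq] at e2
    exact ⟨e1, e2.symm⟩
  have hj : ∀ {i j k l}, i ≠ j → i ≠ k → i ≠ l → j ≠ k → j ≠ l → k ≠ l →
      ⁅p i l, q i k⁆ = ⁅p i j, q i k⁆ ∧ Commute (p j l) ⁅p i j, q i k⁆ := by
    intro i j k l h1 h2 h3 h4 h5 h6
    have hc := hpq h5 h1.symm h4 h3.symm h6.symm h2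
    have e1 := commutator_mul_left_of_commute hc (p i j)
    have e2 := commutator_mul_left_of_commute' hc (p i j)
    rw [hp.mul] at e1
    rw [hp.mul', e1, eq_mul_inv_iff_mul_eq] at e2
    exact ⟨e1, e2.symm⟩
  have hjk : ∀ {i j k j' k'}, i ≠ j → i ≠ k → j ≠ k → i ≠ j' → i ≠ k' → j' ≠ k' →
      ⁅p i j, q i k⁆ = ⁅p i j', q i k'⁆ := by
    intro i j k j' k' h1 h2 h3 h4 h5 h6
    obtain ⟨l, hl⟩ := hα {i, j, k, j', k'} Finset.card_le_five
    simp only [Finset.mem_insert, Finset.mem_singleton, not_or, ← ne_eq] at hl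
    obtain ⟨l1, l2, l3, l4, l5⟩ := hl
    rw [← (hk h1 h2 l1.symm h3 l2.symm l3.symm).1, ← (hk h4 h5 l1.symm h6 l4.symm l5.symm).1]
    by_cases h : j = j'
    · rw [h]
    · exact ((hj h1 l1.symm h4 l2.symm h l4).1).symm
  have hex : ∀ i, ∃ z : G, ∀ {j k}, i ≠ j → i ≠ k → j ≠ k → ⁅p i j, q i k⁆ = z := by
    intro i
    obtain ⟨j, hj⟩ := hα {i} (by simp)
    obtain ⟨k, hk⟩ := hα {i, j} (Finset.card_le_two.trans (by norm_num))
    simp only [Finset.mem_insert, Finset.mem_singleton, not_or, ← ne_eq] at hj hk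
    exact ⟨_, fun h1 h2 h3 => hjk h1 h2 h3 hj.symm hk.1.symm hk.2.symm⟩
  choose z hz using hex
  refine ⟨z, fun {i j k} h1 h2 h3 => hz i h1 h2 h3, ?_, ?_⟩
  · intro i j k h1 h2
    by_cases h : j = k
    · rw [h, hp.self]
      exact Commute.one_left _
    obtain ⟨l, hl⟩ := hα {i, j, k} (Finset.card_le_three.trans (by norm_num))
    simp only [Finset.mem_insert, Finset.mem_singleton, not_or, ← ne_eq] at hl
    obtain ⟨l1, l2, l3⟩ := hl
    rw [← hz i h1 l1.symm l2.symm]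
    exact (hj h1 l1.symm h2 l2.symm h l3).2
  · intro i j k h1 h2
    by_cases h : j = k
    · rw [h, hq.self]
      exact Commute.one_left _
    obtain ⟨l, hl⟩ := hα {i, j, k} (Finset.card_le_three.trans (by norm_num))
    simp only [Finset.mem_insert, Finset.mem_singleton, not_or, ← ne_eq] at hl
    obtain ⟨l1, l2, l3⟩ := hl
    rw [← hz i l1.symm h1 l2]
    exact (hk l1.symm h1 h2 l2 l3 h).2

theorem exists_center (hp : IsTransFamily p) (hq : IsTransFamily q)
    (hα : ∀ s : Finset α, s.card ≤ 5 → ∃ x, x ∉ s)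
    (hpq : ∀ {i j k l}, i ≠ j → i ≠ k → i ≠ l → j ≠ k → j ≠ l → k ≠ l →
      Commute (p i j) (q k l))
    (hr : ∀ {i j k l}, i ≠ j → i ≠ k → i ≠ l → j ≠ k → j ≠ l → k ≠ l →
      p i j * q i k * p j k = q i l * p i k * q l k) :
    ∃ z : G, (∀ i j, Commute (p i j) z) ∧ (∀ i j, Commute (q i j) z) ∧
      (∀ {i j k}, i ≠ j → i ≠ k → j ≠ k → ⁅p i j, q i k⁆ = z) ∧
      ∀ {i k}, i ≠ k → ⁅p i k, q i k⁆ = z * z := by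
  classical
  obtain ⟨z, hz, hzp, hzq⟩ := hp.exists_commutator hq hα hpq
  have hα3 : ∀ i j k, ∃ l, l ≠ i ∧ l ≠ j ∧ l ≠ k := fun i j k => by
    obtain ⟨l, hl⟩ := hα {i, j, k} (Finset.card_le_three.trans (by norm_num))
    simp only [Finset.mem_insert, Finset.mem_singleton, not_or, ← ne_eq] at hl
    exact ⟨l, hl⟩
  have hz' : ∀ {i j k}, i ≠ j → i ≠ k → j ≠ k → p i j * q i k = z i * (q i k * p i j) :=
    fun h1 h2 h3 => by
      rw [← hz h1 h2 h3, commutatorElement_def]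
      group
  have hz'' : ∀ {i j k}, i ≠ j → i ≠ k → j ≠ k → q k i * p j i = p j i * q k i * (z i)⁻¹ :=
    fun h1 h2 h3 => by
      have := congrArg (·⁻¹) (hz' h1 h2 h3)
      simpa only [mul_inv_rev, hp.inv, hq.inv] using this
  have key : ∀ {i k}, i ≠ k → z i * (q i k * p i k) = p i k * q i k * (z k)⁻¹ ∧
      z i * (q i k * p i k) = (z i)⁻¹ * (p i k * q i k) ∧
      z i * (q i k * p i k) = q i k * p i k * z k := by
    intro i k hik
    obtain ⟨j, hj1, hj2, -⟩ := hα3 i k k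
    obtain ⟨l, hl1, hl2, hl3⟩ := hα3 i k j
    have hr' := hr hj1.symm hik hl1.symm hj2 hl3.symm hl2.symm
    have e1 : p i j * q i k * p j k = z i * (q i k * p i k) := by
      rw [hz' hj1.symm hik hj2, mul_assoc, mul_assoc, hp.mul]
    have e2 : p i j * q i k * p j k = p i k * q i k * (z k)⁻¹ := by
      rw [mul_assoc, hz'' hj2.symm hik.symm hj1, ← mul_assoc, ← mul_assoc, hp.mul]
    have e3 : q i l * p i k * q l k = (z i)⁻¹ * (p i k * q i k) := by
      rw [← hq.mul i l k, eq_inv_mul_iff_mul_eq, ← mul_assoc, ← mul_assoc, ← mul_assoc,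
        hz' hik hl1.symm hl2.symm, mul_assoc (z i)]
    have e4 : q i l * p i k * q l k = q i k * p i k * z k := by
      rw [← hq.mul i l k, mul_assoc (q i l) (q l k), hz'' hik.symm hl2.symm hl1.symm]
      group
    exact ⟨e1.symm.trans e2, e1.symm.trans (hr'.trans e3), e1.symm.trans (hr'.trans e4)⟩
  have hv : ∀ i, ∃ v, ∀ k, i ≠ k → z k = v := by
    intro i
    obtain ⟨m, hm, -, -⟩ := hα3 i i i
    let v := (q i m)⁻¹ * z i * q i m
    have h1 : ∀ k, i ≠ k → (q i k)⁻¹ * z i * q i k = v := by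
      intro k hk
      have hc := hzq hm.symm hk
      simp only [v]
      rw [← hq.mul' i m k, mul_inv_rev, mul_assoc (_ * _), ← mul_assoc (z i), ← hc.eq]
      group
    have h2 : ∀ k, i ≠ k → v = p i k * z k * (p i k)⁻¹ := by
      intro k hk
      rw [← h1 k hk, mul_assoc, inv_mul_eq_iff_eq_mul, eq_comm]
      have := (key hk).2.2
      rw [← mul_assoc, ← eq_mul_inv_iff_mul_eq] at this
      rw [this]
      group
    refine ⟨v, fun k hk => ?_⟩
    obtain ⟨l, hl1, hl2, -⟩ := hα3 i k k
    have hvc : Commute (p i k) v := by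
      rw [h2 l hl1.symm]
      exact ((hp.commute _ _ _ _).mul_right (hzp hl1 hl2)).mul_right
        (hp.commute _ _ _ _).inv_right
    have := h2 k hk
    rw [eq_mul_inv_iff_mul_eq, ← hvc.eq] at this
    exact (mul_left_cancel this).symm
  have hzz : ∀ i j, z i = z j := by
    intro i j
    obtain ⟨l, hl1, hl2, -⟩ := hα3 i j j
    obtain ⟨v, hv⟩ := hv l
    rw [hv i hl1, hv j hl2]
  obtain ⟨o, -⟩ := hα ∅ (by simp)
  refine ⟨z o, fun i j => ?_, fun i j => ?_, fun {i j k} h1 h2 h3 => ?_, fun {i k} hik => ?_⟩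
  · obtain ⟨l, hl1, hl2, -⟩ := hα3 i j j
    rw [hzz o l]
    exact hzp hl1 hl2
  · obtain ⟨l, hl1, hl2, -⟩ := hα3 i j j
    rw [hzz o l]
    exact hzq hl1 hl2
  · rw [hz h1 h2 h3, hzz i o]
  · have := (key hik).2.1
    rw [eq_inv_mul_iff_mul_eq, ← mul_assoc] at this
    rw [commutatorElement_def, ← this, hzz o i]
    group

end IsTransFamily

end Translations

section NormalForm

open scoped commutatorElement

variable {G ι : Type*} [Group G] [Fintype ι] [DecidableEq ι]

theorem monoidHom_ext_single {f g : Multiplicative (ι → ℤ) →* G}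
    (h : ∀ i, f (.ofAdd (Pi.single i 1)) = g (.ofAdd (Pi.single i 1))) : f = g := by
  let e : Multiplicative (ι → ℤ) ≃* (ι → Multiplicative ℤ) := 
    MulEquiv.piMultiplicative (fun _ : ι => ℤ)
  have : f.comp e.symm.toMonoidHom = g.comp e.symm.toMonoidHom := by
    refine MonoidHom.noncommPiCoprodEquiv.symm.injective (Subtype.ext (funext fun i => ?_))
    exact MonoidHom.ext_mint (h i)
  exact MonoidHom.ext fun a => DFunLike.congr_fun this (e a)

theorem exists_monoidHom_single {p : ι → G} (hp : ∀ i j, Commute (p i) (p j)) :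
    ∃ P : Multiplicative (ι → ℤ) →* G, ∀ i, P (.ofAdd (Pi.single i 1)) = p i := by
  let e : Multiplicative (ι → ℤ) ≃* (ι → Multiplicative ℤ) := 
    MulEquiv.piMultiplicative (fun _ : ι => ℤ)
  let P := MonoidHom.noncommPiCoprod (fun i => zpowersHom G (p i))
    (fun i j _ x y => (hp i j).zpow_zpow _ _)
  refine ⟨P.comp e.toMonoidHom, fun i => ?_⟩
  have : e (.ofAdd (Pi.single i 1)) = Pi.mulSingle i (.ofAdd 1) := rfl
  rw [MonoidHom.comp_apply, MulEquiv.toMonoidHom_eq_coe, MonoidHom.coe_coe, this]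
  exact (MonoidHom.noncommPiCoprod_mulSingle _ _ _).trans (zpow_one _)

theorem commutator_mem_of_single {Q : Multiplicative (ι → ℤ) →* G} {N : Subgroup G} [N.Normal]
    {g : G} (h : ∀ i, ⁅g, Q (.ofAdd (Pi.single i 1))⁆ ∈ N) (b : Multiplicative (ι → ℤ)) :
    ⁅g, Q b⁆ ∈ N := by
  have hN : ∀ x, ⁅g, x⁆ ∈ N ↔ (MulAut.conj (g : G ⧸ N)).toMonoidHom (QuotientGroup.mk' N x) =
      QuotientGroup.mk' N x := fun x => by
    rw [← QuotientGroup.eq_one_iff, commutatorElement_def, QuotientGroup.mk_mul,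
      QuotientGroup.mk_inv N x, mul_inv_eq_one]
    rfl
  have : ((MulAut.conj (g : G ⧸ N)).toMonoidHom.comp (QuotientGroup.mk' N)).comp Q =
      (QuotientGroup.mk' N).comp Q := monoidHom_ext_single fun i => (hN _).mp (h i)
  exact (hN _).mpr (DFunLike.congr_fun this b)

theorem exists_normalForm {P Q : Multiplicative (ι → ℤ) →* G} {z : G}
    (hz : z ∈ Subgroup.center G)
    (hpq : ∀ i j, ⁅P (.ofAdd (Pi.single i 1)), Q (.ofAdd (Pi.single j 1))⁆ ∈ Subgroup.zpowers z)
    {g : G} (hg : g ∈ Subgroup.closure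
      (insert z (Set.range P ∪ Set.range Q))) :
    ∃ a b, ∃ c : ℤ, g = Q b * P a * z ^ c := by
  have hzc : ∀ (n : ℤ) g, z ^ n * g = g * z ^ n := fun n g =>
    ((Subgroup.mem_center_iff.mp (zpow_mem hz n)) g).symm
  have : (Subgroup.zpowers z).Normal := ⟨fun x hx g => by
    obtain ⟨n, rfl⟩ := hx
    simp only
    rw [← hzc, mul_inv_cancel_right]
    exact ⟨n, rfl⟩⟩
  have hPQ : ∀ a b, ∃ n : ℤ, P a * Q b = Q b * P a * z ^ n := by
    intro a b
    have h : ⁅P a, Q b⁆ ∈ Subgroup.zpowers z := by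
      refine commutator_mem_of_single (fun j => ?_) b
      rw [← inv_mem_iff, commutatorElement_inv]
      refine commutator_mem_of_single (fun i => ?_) a
      rw [← inv_mem_iff, commutatorElement_inv]
      exact hpq i j
    obtain ⟨n, hn⟩ := h
    refine ⟨n, ?_⟩
    simp only [commutatorElement_def] at hn
    rw [← hzc, hn]
    group
  induction hg using Subgroup.closure_induction with
  | mem x hx =>
    rcases hx with rfl | ⟨a, rfl⟩ | ⟨b, rfl⟩
    · exact ⟨1, 1, 1, by simp⟩
    · exact ⟨a, 1, 0, by simp⟩
    · exact ⟨1, b, 0, by simp⟩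
  | one => exact ⟨1, 1, 0, by simp⟩
  | mul x y _ _ hx hy =>
    obtain ⟨a, b, c, rfl⟩ := hx
    obtain ⟨a', b', c', rfl⟩ := hy
    obtain ⟨n, hn⟩ := hPQ a b'
    refine ⟨a * a', b * b', n + (c + c'), ?_⟩
    calc _ = Q b * (P a * (z ^ c * Q b')) * P a' * z ^ c' := by simp only [mul_assoc]
      _ = Q b * (P a * Q b') * (z ^ c * P a') * z ^ c' := by rw [hzc]; simp only [mul_assoc]
      _ = Q b * Q b' * P a * (z ^ n * P a') * z ^ c * z ^ c' := by
        rw [hn, hzc]; simp only [mul_assoc]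
      _ = _ := by rw [hzc, map_mul, map_mul, zpow_add, zpow_add]; simp only [mul_assoc]
  | inv x _ hx =>
    obtain ⟨a, b, c, rfl⟩ := hx
    obtain ⟨n, hn⟩ := hPQ a⁻¹ b⁻¹
    refine ⟨a⁻¹, b⁻¹, n + -c, ?_⟩
    rw [mul_inv_rev, mul_inv_rev, ← zpow_neg, hzc, ← map_inv, ← map_inv, hn, zpow_add]
    simp only [mul_assoc]

end NormalForm

namespace Heis

open scoped commutatorElement

/-- The elements with only `x`-coordinates. -/
def xHom : Multiplicative (Fin 18 → ℤ) →* Heis where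
  toFun a := ⟨a.toAdd, 0, 0⟩
  map_one' := rfl
  map_mul' a b := by ext <;> simp

/-- The elements with only `y`-coordinates. -/
def yHom : Multiplicative (Fin 18 → ℤ) →* Heis where
  toFun b := ⟨0, b.toAdd, 0⟩
  map_one' := rfl
  map_mul' a b := by ext <;> simp

/-- The central elements. -/
def zHom : Multiplicative ℤ →* Heis where
  toFun c := ⟨0, 0, c.toAdd⟩
  map_one' := rfl
  map_mul' a b := by ext <;> simp

/-- The generator of the center. -/
def zGen : Heis := ⟨0, 0, 1⟩

theorem zGen_zpow (c : ℤ) : zGen ^ c = ⟨0, 0, c⟩ := by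
  have := map_zpow zHom (.ofAdd 1) c
  rw [← ofAdd_zsmul, smul_eq_mul, mul_one] at this
  exact this.symm

theorem yHom_mul_xHom_mul (a b : Fin 18 → ℤ) (c : ℤ) :
    yHom (.ofAdd b) * xHom (.ofAdd a) * zGen ^ c = ⟨a, b, c⟩ := by
  rw [zGen_zpow]
  ext <;> simp [xHom, yHom]

/-- The images of the generators of the presented Heisenberg group. -/
def gen : HGen → Heis
  | .x i => ⟨Pi.single i 1, 0, 0⟩
  | .y i => ⟨0, Pi.single i 1, 0⟩
  | .z => zGen

theorem gen_rels : ∀ r ∈ HRels, FreeGroup.lift gen r = 1 := by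
  rintro r (⟨i, j, h, rfl⟩ | ⟨i, j, h, rfl⟩ | ⟨i, j, h, rfl⟩ | ⟨i, rfl⟩ | ⟨i, rfl⟩ | ⟨i, rfl⟩) <;>
  ext <;> simp [fx, fy, fz, gen, zGen, *]

/-- The coordinates on the presented Heisenberg group. -/
def ofH : Hgrp →* Heis := PresentedGroup.toGroup gen_rels

@[simp] theorem ofH_xH (i : Fin 18) : ofH (xH i) = ⟨Pi.single i 1, 0, 0⟩ :=
  PresentedGroup.toGroup.of gen_rels

@[simp] theorem ofH_yH (i : Fin 18) : ofH (yH i) = ⟨0, Pi.single i 1, 0⟩ :=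
  PresentedGroup.toGroup.of gen_rels

@[simp] theorem ofH_zH : ofH zH = zGen := PresentedGroup.toGroup.of gen_rels

theorem xH_commute {i j : Fin 18} (h : i ≠ j) : Commute (xH i) (xH j) :=
  commutatorElement_eq_one_iff_commute.mp
    (PresentedGroup.one_of_mem (rels := HRels) (Or.inl ⟨i, j, h, rfl⟩))

theorem yH_commute {i j : Fin 18} (h : i ≠ j) : Commute (yH i) (yH j) :=
  commutatorElement_eq_one_iff_commute.mp
    (PresentedGroup.one_of_mem (rels := HRels) (Or.inr (Or.inl ⟨i, j, h, rfl⟩)))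

theorem xH_commute_yH {i j : Fin 18} (h : i ≠ j) : Commute (xH i) (yH j) :=
  commutatorElement_eq_one_iff_commute.mp
    (PresentedGroup.one_of_mem (rels := HRels) (Or.inr (Or.inr (Or.inl ⟨i, j, h, rfl⟩))))

theorem commutator_xH_yH (i : Fin 18) : ⁅xH i, yH i⁆ = zH :=
  mul_inv_eq_one.mp
    (PresentedGroup.one_of_mem (rels := HRels) (Or.inr (Or.inr (Or.inr (Or.inl ⟨i, rfl⟩)))))

theorem xH_commute_zH (i : Fin 18) : Commute (xH i) zH :=
  commutatorElement_eq_one_iff_commute.mp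
    (PresentedGroup.one_of_mem (rels := HRels)
      (Or.inr (Or.inr (Or.inr (Or.inr (Or.inl ⟨i, rfl⟩))))))

theorem yH_commute_zH (i : Fin 18) : Commute (yH i) zH :=
  commutatorElement_eq_one_iff_commute.mp
    (PresentedGroup.one_of_mem (rels := HRels)
      (Or.inr (Or.inr (Or.inr (Or.inr (Or.inr ⟨i, rfl⟩))))))

theorem zH_mem_center : zH ∈ Subgroup.center Hgrp := by
  refine Subgroup.mem_center_iff.mpr fun g => ?_
  refine Subgroup.mem_centralizer_singleton_iff.mp (PresentedGroup.generated_by HRels _ ?_ g)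
  rintro (i | i | -)
  · exact Subgroup.mem_centralizer_singleton_iff.mpr (xH_commute_zH i)
  · exact Subgroup.mem_centralizer_singleton_iff.mpr (yH_commute_zH i)
  · exact Subgroup.mem_centralizer_singleton_iff.mpr rfl

theorem exists_ofH_normalForm : ∃ X Y : Multiplicative (Fin 18 → ℤ) →* Hgrp,
    ofH.comp X = xHom ∧ ofH.comp Y = yHom ∧ ∀ g, ∃ a b, ∃ c : ℤ, g = Y b * X a * zH ^ c := by
  obtain ⟨X, hX⟩ := exists_monoidHom_single (p := xH) fun i j => by
    by_cases h : i = j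
    · rw [h]
    · exact xH_commute h
  obtain ⟨Y, hY⟩ := exists_monoidHom_single (p := yH) fun i j => by
    by_cases h : i = j
    · rw [h]
    · exact yH_commute h
  refine ⟨X, Y, monoidHom_ext_single fun i => ?_, monoidHom_ext_single fun i => ?_, fun g => ?_⟩
  · rw [MonoidHom.comp_apply, hX, ofH_xH]
    rfl
  · rw [MonoidHom.comp_apply, hY, ofH_yH]
    rfl
  · refine exists_normalForm zH_mem_center (fun i j => ?_) ?_
    · rw [hX, hY]
      by_cases h : i = j
      · rw [h, commutator_xH_yH]
        exact Subgroup.mem_zpowers _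
      · rw [(xH_commute_yH h).commutator_eq]
        exact one_mem _
    · have hg : g ∈ (⊤ : Subgroup Hgrp) := Subgroup.mem_top g
      rw [← PresentedGroup.closure_range_of HRels] at hg
      refine Subgroup.closure_mono ?_ hg
      rintro _ ⟨(i | i | -), rfl⟩
      · exact Or.inr (Or.inl ⟨_, hX i⟩)
      · exact Or.inr (Or.inr ⟨_, hY i⟩)
      · exact Or.inl rfl

theorem ofH_bijective : Function.Bijective ofH := by
  obtain ⟨X, Y, hX, hY, h⟩ := exists_ofH_normalForm
  have key : ∀ a b, ∀ c : ℤ, ofH (Y b * X a * zH ^ c) = ⟨a.toAdd, b.toAdd, c⟩ := by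
    intro a b c
    rw [map_mul, map_mul, ← MonoidHom.comp_apply, hY, ← MonoidHom.comp_apply, hX, map_zpow, ofH_zH]
    exact yHom_mul_xHom_mul _ _ _
  constructor
  · rw [injective_iff_map_eq_one]
    intro g hg
    obtain ⟨a, b, c, rfl⟩ := h g
    rw [key, Heis.ext_iff] at hg
    obtain ⟨ha, hb, hc⟩ := hg
    obtain rfl : a = 1 := ha
    obtain rfl : b = 1 := hb
    obtain rfl : c = 0 := hc
    simp
  · exact fun g => ⟨_, key (.ofAdd g.a) (.ofAdd g.b) g.c⟩

end Heis

namespace IsReflFamily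

variable {G α : Type*} [Group G] [DecidableEq α] {ρ : Equiv.Perm α →* G} {X Y : α → α → G}

/-- The translations attached to a family of reflections. -/
def trans (ρ : Equiv.Perm α →* G) (X : α → α → G) (i j : α) : G :=
  if i = j then 1 else X i j * ρ (Equiv.swap i j)

theorem trans_self (i : α) : trans ρ X i i = 1 := if_pos rfl

theorem trans_of_ne {i j : α} (h : i ≠ j) : trans ρ X i j = X i j * ρ (Equiv.swap i j) := if_neg h

theorem eq_trans_mul {i j : α} (h : i ≠ j) : X i j = trans ρ X i j * ρ (Equiv.swap i j) := by
  rw [trans_of_ne h, mul_assoc, map_swap_mul_self, mul_one]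

theorem isTransFamily (hX : IsReflFamily ρ X) : IsTransFamily (trans ρ X) where
  mul i j k := by
    by_cases hij : i = j
    · rw [hij, trans_self, one_mul]
    by_cases hjk : j = k
    · rw [hjk, trans_self, mul_one]
    by_cases hik : i = k
    · rw [← hik, trans_self, trans_of_ne hij, trans_of_ne (Ne.symm hij), hX.trans_mul_symm hij]
    · rw [trans_of_ne hij, trans_of_ne hjk, trans_of_ne hik, hX.trans_mul_trans hij hjk hik]
  mul' i j k := by
    by_cases hij : i = j
    · rw [hij, trans_self, mul_one]
    by_cases hjk : j = k
    · rw [hjk, trans_self, one_mul]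
    by_cases hik : i = k
    · rw [← hik, trans_self, trans_of_ne hij, trans_of_ne (Ne.symm hij),
        hX.trans_mul_symm (Ne.symm hij)]
    · rw [trans_of_ne hij, trans_of_ne hjk, trans_of_ne hik, hX.trans_mul_trans' hij hjk hik]

theorem map_mul_trans (hX : IsReflFamily ρ X) (τ : Equiv.Perm α) (i j : α) :
    ρ τ * trans ρ X i j = trans ρ X (τ i) (τ j) * ρ τ := by
  by_cases h : i = j
  · rw [h, trans_self, trans_self, mul_one, one_mul]
  · rw [trans_of_ne h, trans_of_ne (τ.injective.ne h), ← mul_assoc, hX.map_mul_eq τ h, mul_assoc,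
      mul_assoc, ← map_mul, ← map_mul, Equiv.swap_apply_apply, inv_mul_cancel_right]

theorem commute_trans (hX : IsReflFamily ρ X) (hY : IsReflFamily ρ Y)
    {i j k l : α} (hij : i ≠ j) (hik : i ≠ k) (hil : i ≠ l) (hjk : j ≠ k) (hjl : j ≠ l)
    (hkl : k ≠ l) (h : Commute (X i j) (Y k l)) :
    Commute (trans ρ X i j) (trans ρ Y k l) := by
  have h1 := hX.map_mul_trans (Equiv.swap k l) i j
  rw [Equiv.swap_apply_of_ne_of_ne hik hil, Equiv.swap_apply_of_ne_of_ne hjk hjl] at h1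
  have h2 := hY.map_mul_eq (Equiv.swap i j) hkl
  rw [Equiv.swap_apply_of_ne_of_ne hik.symm hjk.symm,
    Equiv.swap_apply_of_ne_of_ne hil.symm hjl.symm] at h2
  rw [trans_of_ne hkl]
  refine Commute.mul_right ?_ h1.symm
  rw [trans_of_ne hij]
  exact h.mul_left h2

theorem trans_mul_trans_mul_trans (hX : IsReflFamily ρ X) (hY : IsReflFamily ρ Y)
    {i j k : α} (hij : i ≠ j) (hik : i ≠ k) (hjk : j ≠ k) :
    X i j * Y j k * X i j =
      trans ρ X i j * trans ρ Y i k * trans ρ X j k * ρ (Equiv.swap i k) := by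
  have h1 := hY.map_mul_trans (Equiv.swap i j) j k
  rw [Equiv.swap_apply_right, Equiv.swap_apply_of_ne_of_ne hik.symm hjk.symm] at h1
  have h2 := hX.map_mul_trans (Equiv.swap i j * Equiv.swap j k) i j
  rw [Equiv.Perm.mul_apply, Equiv.Perm.mul_apply, Equiv.swap_apply_left,
    Equiv.swap_apply_of_ne_of_ne hij hik, Equiv.swap_apply_left,
    Equiv.swap_apply_of_ne_of_ne hik.symm hjk.symm, map_mul] at h2
  have h3 : Equiv.swap i j * Equiv.swap j k * Equiv.swap i j = Equiv.swap i k := by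
    rw [Equiv.swap_comm i j, Equiv.swap_comm j k,
      Equiv.swap_mul_swap_mul_swap hjk.symm hik.symm]
  rw [eq_trans_mul (ρ := ρ) (X := X) hij, eq_trans_mul (ρ := ρ) (X := Y) hjk, ← h3, map_mul,
    map_mul]
  calc _ = trans ρ X i j * (ρ (Equiv.swap i j) * trans ρ Y j k) *
        (ρ (Equiv.swap j k) * trans ρ X i j) * ρ (Equiv.swap i j) := by simp only [mul_assoc]
    _ = trans ρ X i j * trans ρ Y i k * (ρ (Equiv.swap i j) * ρ (Equiv.swap j k) *
        trans ρ X i j) * ρ (Equiv.swap i j) := by rw [h1]; simp only [mul_assoc]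
    _ = _ := by rw [h2]; simp only [mul_assoc]

end IsReflFamily

namespace Heis

open scoped commutatorElement
open IsReflFamily

theorem diff_self {g : ℤ × ℤ} (hg : g.1 * g.2 = 0) (i : Fin 18) : diff g i i = 1 := by
  ext <;> simp [diff, hg]

theorem refl_mul_inr (g : ℤ × ℤ) (i j : Fin 18) :
    refl g i j * SemidirectProduct.inr (Equiv.swap i j) = SemidirectProduct.inl (diff g i j) := by
  ext1 <;> simp

theorem ofC_trans {X : Fin 18 → Fin 18 → Cgrp} (hX : IsReflFamily rho X) {g : ℤ × ℤ}
    (hg : g.1 * g.2 = 0) {a b : Fin 18} (hab : a ≠ b) (h : ofC (X a b) = refl g a b)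
    (i j : Fin 18) : ofC (trans rho X i j) = SemidirectProduct.inl (diff g i j) := by
  by_cases hij : i = j
  · rw [hij, trans_self, diff_self hg, map_one, map_one]
  obtain ⟨σ, rfl, rfl⟩ := exists_perm_two hab hij
  rw [trans_of_ne hij, ← hX.equivariant σ hab, map_mul, map_mul, map_mul, map_inv, ofC_rho, ofC_rho,
    h, inr_conj_refl, refl_mul_inr]

theorem commutator_diff : ⁅diff (1, 0) 0 1, diff (0, 1) 0 2⁆ = zGen := by
  ext <;> simp [commutatorElement_def, diff, zGen, root_dotProduct_root]

/-- The vectors with coordinate sum zero, parametrized by all coordinates but the first. -/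
def sumZero : Multiplicative (Fin 17 → ℤ) →* Multiplicative (Fin 18 → ℤ) :=
  AddMonoidHom.toMultiplicative
    { toFun := fun a => Fin.cons (-∑ i, a i) a
      map_zero' := by
        ext i
        refine Fin.cases ?_ (fun i => ?_) i <;> simp
      map_add' := fun a b => by
        ext i
        refine Fin.cases ?_ (fun i => ?_) i <;> simp [Finset.sum_add_distrib, add_comm] }

theorem sumZero_single (i : Fin 17) :
    sumZero (.ofAdd (Pi.single i 1)) = .ofAdd (root i.succ 0) := by
  refine congrArg Multiplicative.ofAdd (funext fun k => ?_)
  refine Fin.cases ?_ (fun k => ?_) k <;> simp [root, Pi.single_apply, Fin.succ_ne_zero]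

theorem exists_translations : ∃ (p q : Fin 18 → Fin 18 → Cgrp) (z : Cgrp),
    IsTransFamily p ∧ IsTransFamily q ∧
    (∀ τ i j, rho τ * p i j = p (τ i) (τ j) * rho τ) ∧
    (∀ τ i j, rho τ * q i j = q (τ i) (τ j) * rho τ) ∧ z ∈ Subgroup.center Cgrp ∧
    (∀ i j k, i ≠ j → i ≠ k → ⁅p i j, q i k⁆ ∈ Subgroup.zpowers z) ∧
    (∀ i j, ofC (p i j) = SemidirectProduct.inl (diff (1, 0) i j)) ∧
    (∀ i j, ofC (q i j) = SemidirectProduct.inl (diff (0, 1) i j)) ∧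
    ofC z = SemidirectProduct.inl zGen ∧
    ∀ H : Subgroup Cgrp, (∀ i j, p i j ∈ H) → (∀ i j, q i j ∈ H) → rho.range ≤ H → H = ⊤ := by
  obtain ⟨X, Y, hX, hY, hc, hr, hX0, hY0, hgen⟩ := exists_families
  have hα : ∀ s : Finset (Fin 18), s.card ≤ 5 → ∃ x, x ∉ s := by
    intro s hs
    by_contra! h
    rw [Finset.eq_univ_iff_forall.mpr h, Finset.card_univ, Fintype.card_fin] at hs
    omega
  obtain ⟨z, hpz, hqz, hz, hzz⟩ := hX.isTransFamily.exists_center hY.isTransFamily hα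
    (fun h1 h2 h3 h4 h5 h6 => hX.commute_trans hY h1 h2 h3 h4 h5 h6 (hc h1 h2 h3 h4 h5 h6))
    (fun {i j k l} h1 h2 h3 h4 h5 h6 => by
      have := hr h1 h2 h3 h4 h5 h6
      rw [hX.trans_mul_trans_mul_trans hY h1 h2 h4,
        hY.trans_mul_trans_mul_trans hX h3 h2 h6.symm] at this
      exact mul_right_cancel this)
  have hofp := ofC_trans hX (g := (1, 0)) rfl (show (5 : Fin 18) ≠ 0 by decide) (by
    rw [hX0, ofC_uC]; rfl)
  have hofq := ofC_trans hY (g := (0, 1)) rfl (show (0 : Fin 18) ≠ 17 by decide) (by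
    rw [hY0, ofC_uC]; rfl)
  have htop : ∀ H : Subgroup Cgrp, (∀ i j, trans rho X i j ∈ H) → (∀ i j, trans rho Y i j ∈ H) →
      rho.range ≤ H → H = ⊤ := by
    intro H hp hq hρ
    have hXH : ∀ i j, i ≠ j → X i j ∈ H := fun i j hij => by
      rw [eq_trans_mul (ρ := rho) (X := X) hij]
      exact mul_mem (hp i j) (hρ ⟨_, rfl⟩)
    have hYH : ∀ i j, i ≠ j → Y i j ∈ H := fun i j hij => by
      rw [eq_trans_mul (ρ := rho) (X := Y) hij]
      exact mul_mem (hq i j) (hρ ⟨_, rfl⟩)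
    rw [eq_top_iff]
    refine fun g _ => PresentedGroup.generated_by _ H (fun e => ?_) g
    change uC e ∈ H
    rcases hgen e with ⟨σ, h⟩ | ⟨i, j, hij, h⟩ | ⟨i, j, hij, h⟩ | ⟨i, j, k, hij, hjk, h⟩ <;> rw [h]
    · exact hρ ⟨σ, rfl⟩
    · exact hXH i j hij
    · exact hYH i j hij
    · exact mul_mem (mul_mem (hXH i j hij) (hYH j k hjk)) (hXH i j hij)
  have hz0 := hz (show (0 : Fin 18) ≠ 1 by decide) (show (0 : Fin 18) ≠ 2 by decide)
    (show (1 : Fin 18) ≠ 2 by decide)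
  refine ⟨trans rho X, trans rho Y, z, hX.isTransFamily, hY.isTransFamily, hX.map_mul_trans,
    hY.map_mul_trans, ?_, ?_, hofp, hofq, ?_, htop⟩
  · have h : Subgroup.centralizer {z} = ⊤ := by
      refine htop _ (fun i j => Subgroup.mem_centralizer_singleton_iff.mpr (hpz i j))
        (fun i j => Subgroup.mem_centralizer_singleton_iff.mpr (hqz i j)) ?_
      rintro _ ⟨σ, rfl⟩
      rw [Subgroup.mem_centralizer_singleton_iff]
      have h1 := map_commutatorElement (MulAut.conj (rho σ)) (trans rho X 0 1) (trans rho Y 0 2)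
      rw [MulAut.conj_apply, MulAut.conj_apply, MulAut.conj_apply, hX.map_mul_trans,
        hY.map_mul_trans, mul_inv_cancel_right, mul_inv_cancel_right, hz0,
        hz (σ.injective.ne (by decide)) (σ.injective.ne (by decide))
          (σ.injective.ne (by decide)), mul_inv_eq_iff_eq_mul] at h1
      exact h1
    refine Subgroup.mem_center_iff.mpr fun g => ?_
    exact Subgroup.mem_centralizer_singleton_iff.mp (h ▸ Subgroup.mem_top g)
  · intro i j k hij hik
    by_cases hjk : j = k
    · rw [← hjk, hzz hij]
      exact mul_mem (Subgroup.mem_zpowers z) (Subgroup.mem_zpowers z)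
    · rw [hz hij hik hjk]
      exact Subgroup.mem_zpowers z
  · rw [← hz0, map_commutatorElement, hofp, hofq, ← map_commutatorElement, commutator_diff]

theorem exists_ofC_normalForm : ∃ (P Q : Multiplicative (Fin 17 → ℤ) →* Cgrp) (z : Cgrp),
    ofC.comp P = SemidirectProduct.inl.comp (xHom.comp sumZero) ∧
    ofC.comp Q = SemidirectProduct.inl.comp (yHom.comp sumZero) ∧
    ofC z = SemidirectProduct.inl zGen ∧
    ∀ g, ∃ a b, ∃ c : ℤ, ∃ σ, g = Q b * P a * z ^ c * rho σ := by
  obtain ⟨p, q, z, hp, hq, hρp, hρq, hz, hpq, hofp, hofq, hofz, htop⟩ := exists_translations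
  obtain ⟨P, hP⟩ := exists_monoidHom_single (p := fun i : Fin 17 => p i.succ 0)
    fun i j => hp.commute _ _ _ _
  obtain ⟨Q, hQ⟩ := exists_monoidHom_single (p := fun i : Fin 17 => q i.succ 0)
    fun i j => hq.commute _ _ _ _
  refine ⟨P, Q, z, monoidHom_ext_single fun i => ?_, monoidHom_ext_single fun i => ?_, hofz, ?_⟩
  · simp only [MonoidHom.comp_apply, hP, hofp, sumZero_single]
    exact congrArg _ (by ext <;> simp [diff, xHom])
  · simp only [MonoidHom.comp_apply, hQ, hofq, sumZero_single]
    exact congrArg _ (by ext <;> simp [diff, yHom])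
  let N := Subgroup.closure (insert z (Set.range P ∪ Set.range Q))
  have hPN : ∀ a, P a ∈ N := fun a => Subgroup.subset_closure (Or.inr (Or.inl ⟨a, rfl⟩))
  have hQN : ∀ a, Q a ∈ N := fun a => Subgroup.subset_closure (Or.inr (Or.inr ⟨a, rfl⟩))
  have hpN : ∀ i j, p i j ∈ N := by
    have h : ∀ i, p i 0 ∈ N := Fin.cases (by rw [hp.self]; exact one_mem _) fun i => hP i ▸ hPN _
    intro i j
    rw [← hp.mul i 0 j, ← hp.inv j 0]
    exact mul_mem (h i) (inv_mem (h j))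
  have hqN : ∀ i j, q i j ∈ N := by
    have h : ∀ i, q i 0 ∈ N := Fin.cases (by rw [hq.self]; exact one_mem _) fun i => hQ i ▸ hQN _
    intro i j
    rw [← hq.mul i 0 j, ← hq.inv j 0]
    exact mul_mem (h i) (inv_mem (h j))
  let M := Subgroup.closure (insert z (Set.range p.uncurry ∪ Set.range q.uncurry))
  have hpM : ∀ i j, p i j ∈ M := fun i j =>
    Subgroup.subset_closure (Or.inr (Or.inl ⟨(i, j), rfl⟩))
  have hqM : ∀ i j, q i j ∈ M := fun i j =>
    Subgroup.subset_closure (Or.inr (Or.inr ⟨(i, j), rfl⟩))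
  have hMN : M ≤ N := by
    rw [Subgroup.closure_le]
    rintro _ (rfl | ⟨⟨i, j⟩, rfl⟩ | ⟨⟨i, j⟩, rfl⟩)
    · exact Subgroup.subset_closure (Or.inl rfl)
    · exact hpN i j
    · exact hqN i j
  have hconj : ∀ σ, ∀ n ∈ M, rho σ * n * (rho σ)⁻¹ ∈ M := by
    intro σ n hn
    have : M ≤ M.comap (MulAut.conj (rho σ)).toMonoidHom := by
      rw [Subgroup.closure_le]
      rintro _ (rfl | ⟨⟨i, j⟩, rfl⟩ | ⟨⟨i, j⟩, rfl⟩) <;>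
        simp only [SetLike.mem_coe, Subgroup.mem_comap, MulEquiv.coe_toMonoidHom,
          MulAut.conj_apply, Function.uncurry_apply_pair]
      · rw [Subgroup.mem_center_iff.mp hz, mul_inv_cancel_right]
        exact Subgroup.subset_closure (Or.inl rfl)
      · rw [hρp, mul_inv_cancel_right]
        exact hpM _ _
      · rw [hρq, mul_inv_cancel_right]
        exact hqM _ _
    exact this hn
  let H : Subgroup Cgrp :=
    { carrier := {g | ∃ n ∈ M, ∃ σ, g = n * rho σ}
      one_mem' := ⟨1, one_mem M, 1, by simp⟩
      mul_mem' := by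
        rintro _ _ ⟨n, hn, σ, rfl⟩ ⟨m, hm, τ, rfl⟩
        refine ⟨_, mul_mem hn (hconj σ m hm), σ * τ, ?_⟩
        rw [map_mul]
        group
      inv_mem' := by
        rintro _ ⟨n, hn, σ, rfl⟩
        refine ⟨_, hconj σ⁻¹ _ (inv_mem hn), σ⁻¹, ?_⟩
        rw [map_inv]
        group }
  have hH : H = ⊤ := htop H (fun i j => ⟨_, hpM i j, 1, by simp⟩)
    (fun i j => ⟨_, hqM i j, 1, by simp⟩) fun _ ⟨σ, h⟩ => ⟨1, one_mem M, σ, by simp [h]⟩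
  intro g
  obtain ⟨n, hn, σ, rfl⟩ : g ∈ H := hH ▸ Subgroup.mem_top g
  have hpq' : ∀ i j : Fin 17, ⁅p i.succ 0, q j.succ 0⁆ ∈ Subgroup.zpowers z := by
    intro i j
    obtain ⟨n, hn⟩ := hpq 0 i.succ j.succ (Fin.succ_ne_zero i).symm (Fin.succ_ne_zero j).symm
    refine ⟨n, ?_⟩
    simp only at hn ⊢
    rw [← hp.inv 0, ← hq.inv 0, show ⁅(p 0 i.succ)⁻¹, (q 0 j.succ)⁻¹⁆ =
      (q 0 j.succ * p 0 i.succ)⁻¹ * ⁅p 0 i.succ, q 0 j.succ⁆ * (q 0 j.succ * p 0 i.succ) by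
        simp only [commutatorElement_def]; group, ← hn,
      Subgroup.mem_center_iff.mp (zpow_mem hz n), inv_mul_cancel_right]
  obtain ⟨a, b, c, rfl⟩ := exists_normalForm hz (fun i j => by rw [hP, hQ]; exact hpq' i j) (hMN hn)
  exact ⟨a, b, c, σ, rfl⟩

/-- The sums of the coordinates. -/
def sum : Heis →* Multiplicative (ℤ × ℤ) where
  toFun g := .ofAdd (∑ i, g.a i, ∑ i, g.b i)
  map_one' := by simp
  map_mul' g h := by
    refine congrArg Multiplicative.ofAdd ?_
    simp [Finset.sum_add_distrib]

theorem sum_eq_one_iff {g : Heis} : sum g = 1 ↔ ∑ i, g.a i = 0 ∧ ∑ i, g.b i = 0 :=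
  Prod.ext_iff

theorem sum_ofAdd_sumZero (a : Multiplicative (Fin 17 → ℤ)) : ∑ i, (sumZero a).toAdd i = 0 := by
  simp [sumZero, Fin.sum_univ_succ (n := 17)]

theorem exists_sumZero_eq {a : Fin 18 → ℤ} (h : ∑ i, a i = 0) :
    ∃ b, sumZero b = .ofAdd a := by
  refine ⟨.ofAdd (Fin.tail a), congrArg Multiplicative.ofAdd (funext fun i => ?_)⟩
  rw [Fin.sum_univ_succ] at h
  refine Fin.cases ?_ (fun i => ?_) i
  · change -∑ i : Fin 17, a i.succ = a 0
    omega
  · rfl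

theorem ofC_injective_and_range : Function.Injective ofC ∧
    ∀ w, w ∈ ofC.range ↔ sum w.left = 1 := by
  obtain ⟨P, Q, z, hP, hQ, hz, h⟩ := exists_ofC_normalForm
  have key : ∀ a b, ∀ c : ℤ, ∀ σ, ofC (Q b * P a * z ^ c * rho σ) =
      ⟨⟨(sumZero a).toAdd, (sumZero b).toAdd, c⟩, σ⟩ := by
    intro a b c σ
    rw [map_mul, map_mul, map_mul, ← MonoidHom.comp_apply, hQ, ← MonoidHom.comp_apply, hP, map_zpow,
      hz, ofC_rho, ← map_zpow, ← yHom_mul_xHom_mul]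
    ext1 <;> simp [-map_zpow]
  have hinj : Function.Injective sumZero := fun a b hab =>
    funext fun i => congrFun (a := i.succ) hab
  refine ⟨?_, fun w => ⟨?_, fun hw => ?_⟩⟩
  · rw [injective_iff_map_eq_one]
    intro g hg
    obtain ⟨a, b, c, σ, rfl⟩ := h g
    rw [key, SemidirectProduct.ext_iff, Heis.ext_iff] at hg
    obtain ⟨⟨ha, hb, hc⟩, hσ⟩ := hg
    obtain rfl : a = 1 := hinj (ha.trans (map_one sumZero).symm)
    obtain rfl : b = 1 := hinj (hb.trans (map_one sumZero).symm)
    obtain rfl : c = 0 := hc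
    obtain rfl : σ = 1 := hσ
    simp
  · rintro ⟨g, rfl⟩
    obtain ⟨a, b, c, σ, rfl⟩ := h g
    rw [key, sum_eq_one_iff]
    exact ⟨sum_ofAdd_sumZero a, sum_ofAdd_sumZero b⟩
  · obtain ⟨ha, hb⟩ := sum_eq_one_iff.mp hw
    obtain ⟨a, ha⟩ := exists_sumZero_eq ha
    obtain ⟨b, hb⟩ := exists_sumZero_eq hb
    exact ⟨_, (key a b w.left.c w.right).trans (by rw [ha, hb]; rfl)⟩

end Heis

theorem hgrp_ext {M : Type*} [Group M] {f g : Hgrp →* M} (hx : ∀ i, f (xH i) = g (xH i))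
    (hy : ∀ i, f (yH i) = g (yH i)) (hz : f zH = g zH) : f = g :=
  PresentedGroup.ext fun
    | .x i => hx i
    | .y i => hy i
    | .z => hz

open Heis in
theorem nonempty_mulEquiv {K : Subgroup Hgrp} (hK : ∀ g, g ∈ K ↔ Heis.sum (ofH g) = 1)
    {φ : Equiv.Perm (Fin 18) →* MulAut Hgrp} (hφ : ∀ σ g, ofH (φ σ g) = perm σ (ofH g))
    {φK : Equiv.Perm (Fin 18) →* MulAut K} (hφK : ∀ σ (g : K), (φK σ g : Hgrp) = φ σ g) :
    Nonempty (Cgrp ≃* K ⋊[φK] Equiv.Perm (Fin 18)) := by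
  let F : K ⋊[φK] Equiv.Perm (Fin 18) →* Amb :=
    SemidirectProduct.map (ofH.comp K.subtype) (MonoidHom.id _) fun σ => MonoidHom.ext fun g => by
      simp [hφK, hφ]
  have hF : Function.Injective F := by
    intro v w hvw
    have hl : ofH v.left = ofH w.left := congrArg SemidirectProduct.left hvw
    exact SemidirectProduct.ext (Subtype.ext (ofH_bijective.injective hl))
      (congrArg (fun u : Amb => u.right) hvw)
  obtain ⟨hinj, hrange⟩ := ofC_injective_and_range
  have hr : ofC.range = F.range := by
    ext w
    rw [hrange]
    constructor
    · intro hw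
      obtain ⟨g, hg⟩ := ofH_bijective.surjective w.left
      exact ⟨⟨⟨g, (hK g).mpr (hg ▸ hw)⟩, w.right⟩, SemidirectProduct.ext hg rfl⟩
    · rintro ⟨v, rfl⟩
      exact (hK _).mp v.left.2
  exact ⟨(MonoidHom.ofInjective hinj).trans
    ((MulEquiv.subgroupCongr hr).trans (MonoidHom.ofInjective hF).symm)⟩

/-- The restriction of an action by automorphisms to an invariant subgroup. -/
def restrictAction {S H : Type*} [Group S] [Group H] (φ : S →* MulAut H) (K : Subgroup H)
    (h : ∀ σ, ∀ g ∈ K, φ σ g ∈ K) : S →* MulAut K where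
  toFun σ :=
    { toFun := fun g => ⟨φ σ g, h σ g g.2⟩
      invFun := fun g => ⟨φ σ⁻¹ g, h σ⁻¹ g g.2⟩
      left_inv := fun g => by simp
      right_inv := fun g => by simp
      map_mul' := fun g g' => by simp }
  map_one' := by ext; simp
  map_mul' σ τ := by ext; simp

/-- The group `C` is isomorphic to the semidirect product `K ⋊ S₁₈`, where
`S₁₈` acts on `K = ker(ab)` by the restriction of the index-permutation
action `φ` on `H` (which preserves `K`). -/
theorem stmt5 (ab : Hgrp →* Multiplicative (ℤ × ℤ))
    (habx : ∀ i : Fin 18, ab (xH i) = Multiplicative.ofAdd (1, 0))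
    (haby : ∀ i : Fin 18, ab (yH i) = Multiplicative.ofAdd (0, 1))
    (habz : ab zH = 1)
    (φ : Equiv.Perm (Fin 18) →* MulAut Hgrp)
    (hφx : ∀ (σ : Equiv.Perm (Fin 18)) (i : Fin 18), φ σ (xH i) = xH (σ i))
    (hφy : ∀ (σ : Equiv.Perm (Fin 18)) (i : Fin 18), φ σ (yH i) = yH (σ i))
    (hφz : ∀ σ : Equiv.Perm (Fin 18), φ σ zH = zH) :
    ∃ φK : Equiv.Perm (Fin 18) →* MulAut ↥ab.ker,
      (∀ (σ : Equiv.Perm (Fin 18)) (g : ↥ab.ker),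
          ((φK σ g : ↥ab.ker) : Hgrp) = φ σ (g : Hgrp)) ∧
      Nonempty (Cgrp ≃* (↥ab.ker ⋊[φK] Equiv.Perm (Fin 18))) := by
  have hab : ab = Heis.sum.comp Heis.ofH := by
    refine hgrp_ext (fun i => ?_) (fun i => ?_) ?_
    · rw [habx, MonoidHom.comp_apply, Heis.ofH_xH]
      exact congrArg Multiplicative.ofAdd (by simp)
    · rw [haby, MonoidHom.comp_apply, Heis.ofH_yH]
      exact congrArg Multiplicative.ofAdd (by simp)
    · rw [habz, MonoidHom.comp_apply, Heis.ofH_zH]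
      exact (Heis.sum_eq_one_iff.mpr ⟨Finset.sum_const_zero, Finset.sum_const_zero⟩).symm
  have hφ : ∀ σ g, Heis.ofH (φ σ g) = Heis.perm σ (Heis.ofH g) := by
    intro σ
    have : Heis.ofH.comp (φ σ).toMonoidHom = (Heis.perm σ).toMonoidHom.comp Heis.ofH := by
      refine hgrp_ext (fun i => ?_) (fun i => ?_) ?_
      · simp only [MonoidHom.comp_apply, MulEquiv.coe_toMonoidHom, hφx, Heis.ofH_xH]
        ext <;> simp [Pi.single_apply, Equiv.symm_apply_eq]
      · simp only [MonoidHom.comp_apply, MulEquiv.coe_toMonoidHom, hφy, Heis.ofH_yH]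
        ext <;> simp [Pi.single_apply, Equiv.symm_apply_eq]
      · simp only [MonoidHom.comp_apply, MulEquiv.coe_toMonoidHom, hφz, Heis.ofH_zH]
        rfl
    exact DFunLike.congr_fun this
  have habφ : ∀ σ, ab.comp (φ σ).toMonoidHom = ab := fun σ =>
    hgrp_ext (fun i => by simp [hφx, habx]) (fun i => by simp [hφy, haby]) (by simp [hφz])
  refine ⟨restrictAction φ ab.ker fun σ g hg => ?_, fun σ g => rfl, nonempty_mulEquiv
    (fun g => by rw [MonoidHom.mem_ker, hab]; rfl) hφ fun σ g => rfl⟩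
  exact (DFunLike.congr_fun (habφ σ) g).trans hg
end

section
/- The abelianization of K is isomorphic to the free abelian group ℤ³⁴; equivalently, the commutator subgroup of K is exactly the subgroup generated by z. -/
open scoped commutatorElement

/-- The generators `x i` and `y i` of `H`, indexed together. -/
def genH : Fin 18 ⊕ Fin 18 → Hgrp := Sum.elim xH yH

theorem xH_mul_xH (i j : Fin 18) : xH i * xH j = xH j * xH i := by
  rcases eq_or_ne i j with rfl | h
  · rfl
  have : PresentedGroup.mk HRels (fx i * fx j * (fx i)⁻¹ * (fx j)⁻¹) = 1 :=
    PresentedGroup.one_of_mem (Or.inl ⟨i, j, h, rfl⟩)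
  exact commutatorElement_eq_one_iff_mul_comm.1 this

theorem yH_mul_yH (i j : Fin 18) : yH i * yH j = yH j * yH i := by
  rcases eq_or_ne i j with rfl | h
  · rfl
  have : PresentedGroup.mk HRels (fy i * fy j * (fy i)⁻¹ * (fy j)⁻¹) = 1 :=
    PresentedGroup.one_of_mem (Or.inr (Or.inl ⟨i, j, h, rfl⟩))
  exact commutatorElement_eq_one_iff_mul_comm.1 this

theorem xH_mul_yH_of_ne {i j : Fin 18} (h : i ≠ j) : xH i * yH j = yH j * xH i := by
  have : PresentedGroup.mk HRels (fx i * fy j * (fx i)⁻¹ * (fy j)⁻¹) = 1 :=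
    PresentedGroup.one_of_mem (Or.inr (Or.inr (Or.inl ⟨i, j, h, rfl⟩)))
  exact commutatorElement_eq_one_iff_mul_comm.1 this

theorem commutator_xH_yH (i : Fin 18) : ⁅xH i, yH i⁆ = zH := by
  have : PresentedGroup.mk HRels (fx i * fy i * (fx i)⁻¹ * (fy i)⁻¹ * fz⁻¹) = 1 :=
    PresentedGroup.one_of_mem (Or.inr (Or.inr (Or.inr (Or.inl ⟨i, rfl⟩))))
  exact mul_inv_eq_one.1 this

theorem xH_mul_zH (i : Fin 18) : xH i * zH = zH * xH i := by
  have : PresentedGroup.mk HRels (fx i * fz * (fx i)⁻¹ * fz⁻¹) = 1 :=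
    PresentedGroup.one_of_mem (Or.inr (Or.inr (Or.inr (Or.inr (Or.inl ⟨i, rfl⟩)))))
  exact commutatorElement_eq_one_iff_mul_comm.1 this

theorem yH_mul_zH (i : Fin 18) : yH i * zH = zH * yH i := by
  have : PresentedGroup.mk HRels (fy i * fz * (fy i)⁻¹ * fz⁻¹) = 1 :=
    PresentedGroup.one_of_mem (Or.inr (Or.inr (Or.inr (Or.inr (Or.inr ⟨i, rfl⟩)))))
  exact commutatorElement_eq_one_iff_mul_comm.1 this

theorem zH_mem_center : zH ∈ Subgroup.center Hgrp := by
  have h : (⊤ : Subgroup Hgrp) ≤ Subgroup.centralizer {zH} := by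
    rw [← PresentedGroup.closure_range_of, Subgroup.closure_le]
    rintro _ ⟨i | i | _, rfl⟩ <;> rw [SetLike.mem_coe, Subgroup.mem_centralizer_singleton_iff]
    exacts [xH_mul_zH i, yH_mul_zH i, rfl]
  exact Subgroup.mem_center_iff.2 fun g ↦
    Subgroup.mem_centralizer_singleton_iff.1 (h (Subgroup.mem_top g))

instance normal_zpowers_zH : (Subgroup.zpowers zH).Normal :=
  ⟨fun n hn g ↦ by
    have : n ∈ Subgroup.center Hgrp :=
      Subgroup.zpowers_le.2 zH_mem_center hn
    rwa [Subgroup.mem_center_iff.1 this g, mul_inv_cancel_right]⟩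

/-- The quotient of `H` by the central subgroup generated by `z`. -/
abbrev HmodZ : Type := Hgrp ⧸ Subgroup.zpowers zH

theorem mk_zH : (QuotientGroup.mk zH : HmodZ) = 1 :=
  (QuotientGroup.eq_one_iff _).2 (Subgroup.mem_zpowers _)

theorem mk_xH_mul_mk_yH (i j : Fin 18) :
    (xH i : HmodZ) * (yH j : HmodZ) = (yH j : HmodZ) * (xH i : HmodZ) := by
  rcases eq_or_ne i j with rfl | h
  · rw [← commutatorElement_eq_one_iff_mul_comm]
    exact (congrArg (QuotientGroup.mk' (Subgroup.zpowers zH)) (commutator_xH_yH i)).trans mk_zH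
  · exact congrArg (QuotientGroup.mk' (Subgroup.zpowers zH)) (xH_mul_yH_of_ne h)

theorem closure_range_mk_of :
    Subgroup.closure (Set.range fun g : HGen ↦
      ((PresentedGroup.of g : Hgrp) : HmodZ)) = ⊤ := by
  have h := congrArg (Subgroup.map (QuotientGroup.mk' (Subgroup.zpowers zH)))
    (PresentedGroup.closure_range_of HRels)
  rw [MonoidHom.map_closure, ← Set.range_comp,
    Subgroup.map_top_of_surjective _ (QuotientGroup.mk'_surjective _)] at h
  exact h

instance commGroupHmodZ : CommGroup HmodZ :=
  { (inferInstance : Group HmodZ) with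
    mul_comm := by
      have hcomm : ∀ a b : HGen, ((PresentedGroup.of a : Hgrp) : HmodZ) *
          ((PresentedGroup.of b : Hgrp) : HmodZ) =
          ((PresentedGroup.of b : Hgrp) : HmodZ) * ((PresentedGroup.of a : Hgrp) : HmodZ) := by
        have hz : ((PresentedGroup.of HGen.z : Hgrp) : HmodZ) = 1 := mk_zH
        rintro (i | i | _) (j | j | _)
        · exact congrArg (QuotientGroup.mk' (Subgroup.zpowers zH)) (xH_mul_xH i j)
        · exact mk_xH_mul_mk_yH i j
        · rw [hz, mul_one, one_mul]
        · exact (mk_xH_mul_mk_yH j i).symm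
        · exact congrArg (QuotientGroup.mk' (Subgroup.zpowers zH)) (yH_mul_yH i j)
        · rw [hz, mul_one, one_mul]
        · rw [hz, mul_one, one_mul]
        · rw [hz, mul_one, one_mul]
        · rfl
      have h := Subgroup.closure_le_centralizer_centralizer
        (Set.range fun g : HGen ↦ ((PresentedGroup.of g : Hgrp) : HmodZ))
      have h' : (⊤ : Subgroup HmodZ) ≤ Subgroup.centralizer
          (Set.range fun g : HGen ↦ ((PresentedGroup.of g : Hgrp) : HmodZ)) := by
        rw [← closure_range_mk_of, Subgroup.closure_le]
        rintro _ ⟨a, rfl⟩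
        rw [SetLike.mem_coe, Subgroup.mem_centralizer_iff]
        rintro _ ⟨b, rfl⟩
        exact hcomm b a
      rw [closure_range_mk_of] at h
      intro a b
      exact (Subgroup.mem_centralizer_iff.1 (h (Subgroup.mem_top b)) a
        (h' (Subgroup.mem_top a))) }

/-- The images of the generators of `H` under `exponentsH`. -/
def exponentsGen : HGen → Multiplicative (Fin 18 ⊕ Fin 18 → ℤ)
  | .x i => Multiplicative.ofAdd (Pi.single (Sum.inl i) 1)
  | .y i => Multiplicative.ofAdd (Pi.single (Sum.inr i) 1)
  | .z => 1

/-- The homomorphism recording the total exponents of the generators `x i` and `y i`. -/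
def exponentsH : Hgrp →* Multiplicative (Fin 18 ⊕ Fin 18 → ℤ) :=
  PresentedGroup.toGroup (f := exponentsGen) <| by
    rintro r (⟨i, j, -, rfl⟩ | ⟨i, j, -, rfl⟩ | ⟨i, j, -, rfl⟩ | ⟨i, rfl⟩ | ⟨i, rfl⟩ | ⟨i, rfl⟩) <;>
      simp [fx, fy, fz, exponentsGen, mul_comm]

theorem exponentsH_genH (i : Fin 18 ⊕ Fin 18) :
    exponentsH (genH i) = Multiplicative.ofAdd (Pi.single i 1) := by
  cases i <;> exact PresentedGroup.toGroup.of _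

theorem exponentsH_zH : exponentsH zH = 1 := PresentedGroup.toGroup.of _

/-- The homomorphism sending a vector of exponents to the corresponding product of generators. -/
def ofExponents : Multiplicative (Fin 18 ⊕ Fin 18 → ℤ) →* HmodZ where
  toFun v := ∏ i, (genH i : HmodZ) ^ v.toAdd i
  map_one' := by simp
  map_mul' v w := by simp [zpow_add, Finset.prod_mul_distrib]

theorem ofExponents_single (i : Fin 18 ⊕ Fin 18) :
    ofExponents (Multiplicative.ofAdd (Pi.single i 1)) = (genH i : HmodZ) := by
  change ∏ j, (genH j : HmodZ) ^ (Pi.single i 1 : Fin 18 ⊕ Fin 18 → ℤ) j = _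
  rw [Finset.prod_eq_single i (fun j _ h ↦ by simp [h]) (by simp)]
  simp

theorem ofExponents_comp_exponentsH :
    ofExponents.comp exponentsH = QuotientGroup.mk' (Subgroup.zpowers zH) := by
  refine PresentedGroup.ext fun g ↦ ?_
  rcases g with i | i | _
  · exact (congrArg ofExponents (exponentsH_genH (Sum.inl i))).trans (ofExponents_single _)
  · exact (congrArg ofExponents (exponentsH_genH (Sum.inr i))).trans (ofExponents_single _)
  · exact ((congrArg ofExponents exponentsH_zH).trans (map_one _)).trans mk_zH.symm

theorem ker_exponentsH : exponentsH.ker = Subgroup.zpowers zH := by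
  refine le_antisymm (fun h hh ↦ ?_) (by simpa using exponentsH_zH)
  rw [← QuotientGroup.eq_one_iff]
  have := DFunLike.congr_fun ofExponents_comp_exponentsH h
  rw [MonoidHom.comp_apply, MonoidHom.mem_ker.1 hh, map_one] at this
  exact this.symm

theorem exponentsH_surjective : Function.Surjective exponentsH := by
  intro v
  refine ⟨(List.map (fun i ↦ genH i ^ v.toAdd i) Finset.univ.toList).prod, ?_⟩
  rw [map_list_prod, List.map_map, Finset.prod_map_toList]
  apply Multiplicative.toAdd.injective
  ext j
  cases j <;> simp [exponentsH_genH, toAdd_prod, Finset.sum_apply, Pi.single_apply]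

/-- The homomorphism `ab`, expressed through the exponents of the generators. -/
theorem eq_sum_exponentsH (ab : Hgrp →* Multiplicative (ℤ × ℤ))
    (habx : ∀ i : Fin 18, ab (xH i) = Multiplicative.ofAdd (1, 0))
    (haby : ∀ i : Fin 18, ab (yH i) = Multiplicative.ofAdd (0, 1))
    (habz : ab zH = 1) (h : Hgrp) :
    ab h = Multiplicative.ofAdd (∑ i, (exponentsH h).toAdd (Sum.inl i),
      ∑ i, (exponentsH h).toAdd (Sum.inr i)) := by
  let σ : (Fin 18 ⊕ Fin 18 → ℤ) →+ ℤ × ℤ :=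
    { toFun := fun v ↦ (∑ i, v (Sum.inl i), ∑ i, v (Sum.inr i))
      map_zero' := by simp
      map_add' := fun v w ↦ by simp [Finset.sum_add_distrib] }
  have key : ab = (AddMonoidHom.toMultiplicative σ).comp exponentsH := by
    refine PresentedGroup.ext fun g ↦ ?_
    rcases g with i | i | _
    · refine (habx i).trans ?_
      change _ = Multiplicative.ofAdd (σ (exponentsH (genH (Sum.inl i))).toAdd)
      simp [exponentsH_genH, σ, Pi.single_apply]
    · refine (haby i).trans ?_
      change _ = Multiplicative.ofAdd (σ (exponentsH (genH (Sum.inr i))).toAdd)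
      simp [exponentsH_genH, σ, Pi.single_apply]
    · refine habz.trans ?_
      change _ = Multiplicative.ofAdd (σ (exponentsH zH).toAdd)
      simp [exponentsH_zH]
  exact DFunLike.congr_fun key h

/-- Dropping the last coordinate in both blocks of exponents. -/
def dropLast : (Fin 18 ⊕ Fin 18 → ℤ) →+ (Fin 34 → ℤ) where
  toFun v j := v (Sum.map Fin.castSucc Fin.castSucc ((finSumFinEquiv (m := 17) (n := 17)).symm j))
  map_zero' := rfl
  map_add' _ _ := rfl

theorem dropLast_finSumFinEquiv (v : Fin 18 ⊕ Fin 18 → ℤ) (i : Fin 17 ⊕ Fin 17) :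
    dropLast v (finSumFinEquiv (m := 17) (n := 17) i) =
      v (Sum.map Fin.castSucc Fin.castSucc i) := by
  simp [dropLast]

theorem eq_zero_of_dropLast_eq_zero {v : Fin 18 ⊕ Fin 18 → ℤ}
    (hx : ∑ i, v (Sum.inl i) = 0) (hy : ∑ i, v (Sum.inr i) = 0) (h : dropLast v = 0) : v = 0 := by
  have h' (i : Fin 17 ⊕ Fin 17) : v (Sum.map Fin.castSucc Fin.castSucc i) = 0 := by
    rw [← dropLast_finSumFinEquiv v i, h, Pi.zero_apply]
  have hl (i : Fin 17) : v (Sum.inl i.castSucc) = 0 := h' (Sum.inl i)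
  have hr (i : Fin 17) : v (Sum.inr i.castSucc) = 0 := h' (Sum.inr i)
  rw [Fin.sum_univ_castSucc] at hx hy
  simp only [hl, hr, Finset.sum_const_zero, zero_add] at hx hy
  ext (i | i)
  · exact Fin.lastCases hx hl i
  · exact Fin.lastCases hy hr i

theorem exists_dropLast_eq (w : Fin 34 → ℤ) : ∃ v : Fin 18 ⊕ Fin 18 → ℤ,
    ∑ i, v (Sum.inl i) = 0 ∧ ∑ i, v (Sum.inr i) = 0 ∧ dropLast v = w := by
  let e := finSumFinEquiv (m := 17) (n := 17)
  let a : Fin 17 → ℤ := fun i ↦ w (e (Sum.inl i))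
  let b : Fin 17 → ℤ := fun i ↦ w (e (Sum.inr i))
  refine ⟨Sum.elim (Fin.snoc (α := fun _ ↦ ℤ) a (-∑ i, a i))
    (Fin.snoc (α := fun _ ↦ ℤ) b (-∑ i, b i)), ?_, ?_, ?_⟩
  · rw [Fin.sum_univ_castSucc]
    simp only [Sum.elim_inl, Fin.snoc_castSucc, Fin.snoc_last, add_neg_cancel]
  · rw [Fin.sum_univ_castSucc]
    simp only [Sum.elim_inr, Fin.snoc_castSucc, Fin.snoc_last, add_neg_cancel]
  · ext j
    obtain ⟨i | i, rfl⟩ := e.surjective j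
    · rw [dropLast_finSumFinEquiv]; simp [a]
    · rw [dropLast_finSumFinEquiv]; simp [b]

/-- The commutator of `x 0 * (x 1)⁻¹` and `y 0 * (y 2)⁻¹` is `z`. -/
theorem commutator_xH_div_yH_div : ⁅xH 0 * (xH 1)⁻¹, yH 0 * (yH 2)⁻¹⁆ = zH := by
  have h (i j : Fin 18) (hij : i ≠ j) : Commute (xH i) (yH j) := xH_mul_yH_of_ne hij
  have h1 : Commute (xH 1)⁻¹ (yH 0 * (yH 2)⁻¹) :=
    ((h 1 0 (by decide)).mul_right (h 1 2 (by decide)).inv_right).inv_left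
  have h2 : Commute (xH 0) (yH 2)⁻¹ := (h 0 2 (by decide)).inv_right
  calc ⁅xH 0 * (xH 1)⁻¹, yH 0 * (yH 2)⁻¹⁆
      = xH 0 * ((xH 1)⁻¹ * (yH 0 * (yH 2)⁻¹)) * (xH 1) * (xH 0)⁻¹ * (yH 0 * (yH 2)⁻¹)⁻¹ := by
        rw [commutatorElement_def]; group
    _ = xH 0 * yH 0 * ((yH 2)⁻¹ * (xH 0)⁻¹) * (yH 0 * (yH 2)⁻¹)⁻¹ := by
        rw [h1.eq]; group
    _ = ⁅xH 0, yH 0⁆ := by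
        rw [← h2.inv_left.eq, commutatorElement_def]; group
    _ = zH := commutator_xH_yH 0

/-- The abelianization of `K = ker(ab)` is isomorphic to the free abelian
group `ℤ³⁴`; equivalently, the commutator subgroup of `K` is exactly the
subgroup generated by `z`. -/
theorem stmt12 (ab : Hgrp →* Multiplicative (ℤ × ℤ))
    (habx : ∀ i : Fin 18, ab (xH i) = Multiplicative.ofAdd (1, 0))
    (haby : ∀ i : Fin 18, ab (yH i) = Multiplicative.ofAdd (0, 1))
    (habz : ab zH = 1) :
    ∃ hzK : zH ∈ ab.ker,
      Nonempty (Abelianization ↥ab.ker ≃* Multiplicative (Fin 34 → ℤ)) ∧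
      commutator ↥ab.ker = Subgroup.closure {(⟨zH, hzK⟩ : ↥ab.ker)} := by
  have hzK : zH ∈ ab.ker := habz
  have hker (k : Hgrp) : k ∈ ab.ker ↔ ∑ i, (exponentsH k).toAdd (Sum.inl i) = 0 ∧
      ∑ i, (exponentsH k).toAdd (Sum.inr i) = 0 := by
    rw [MonoidHom.mem_ker, eq_sum_exponentsH ab habx haby habz, ofAdd_eq_one, Prod.mk_eq_zero]
  let ψ : ab.ker →* Multiplicative (Fin 34 → ℤ) :=
    (AddMonoidHom.toMultiplicative dropLast).comp (exponentsH.comp ab.ker.subtype)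
  have hψ : Function.Surjective ψ := by
    intro w
    obtain ⟨v, hx, hy, hv⟩ := exists_dropLast_eq w.toAdd
    obtain ⟨k, hk⟩ := exponentsH_surjective (Multiplicative.ofAdd v)
    refine ⟨⟨k, (hker k).2 (by rw [hk]; exact ⟨hx, hy⟩)⟩, ?_⟩
    change Multiplicative.ofAdd (dropLast (exponentsH k).toAdd) = w
    rw [hk, toAdd_ofAdd, hv, ofAdd_toAdd]
  have h1 : commutator ab.ker ≤ ψ.ker := Abelianization.commutator_subset_ker ψ
  have h2 : ψ.ker ≤ Subgroup.closure {⟨zH, hzK⟩} := by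
    rintro ⟨k, hk⟩ hk'
    obtain ⟨hx, hy⟩ := (hker k).1 hk
    have hk0 : exponentsH k = 1 := eq_zero_of_dropLast_eq_zero hx hy hk'
    rw [← MonoidHom.mem_ker, ker_exponentsH] at hk0
    obtain ⟨n, rfl⟩ := Subgroup.mem_zpowers_iff.1 hk0
    exact Subgroup.mem_closure_singleton.2 ⟨n, rfl⟩
  have h3 : Subgroup.closure {(⟨zH, hzK⟩ : ab.ker)} ≤ commutator ab.ker := by
    rw [Subgroup.closure_le, Set.singleton_subset_iff, SetLike.mem_coe]
    have ha : xH 0 * (xH 1)⁻¹ ∈ ab.ker := by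
      rw [MonoidHom.mem_ker, map_mul, map_inv, habx, habx, mul_inv_cancel]
    have hb : yH 0 * (yH 2)⁻¹ ∈ ab.ker := by
      rw [MonoidHom.mem_ker, map_mul, map_inv, haby, haby, mul_inv_cancel]
    have hz : (⟨zH, hzK⟩ : ab.ker) = ⁅(⟨_, ha⟩ : ab.ker), (⟨_, hb⟩ : ab.ker)⁆ :=
      Subtype.ext commutator_xH_div_yH_div.symm
    rw [hz]
    exact Subgroup.commutator_mem_commutator (Subgroup.mem_top _) (Subgroup.mem_top _)
  exact ⟨hzK, ⟨(QuotientGroup.quotientMulEquivOfEq (le_antisymm h1 (h2.trans h3))).trans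
    (QuotientGroup.quotientKerEquivOfSurjective ψ hψ)⟩, le_antisymm (h1.trans h2) h3⟩
end
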